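/- Let η ∈ ℚ₃ and suppose there exists a sequence (k_j)_{j≥0} of positive integers with k_j → ∞ (in ℝ) and ‖k_j + 1‖₃ → 0 such that the rational numbers −(1 − 3^{2k_j − 1})·B_{2k_j}/(2k_j), viewed in ℚ₃, converge to η (i.e. η = ζ₃(3)). Then η is not in the image of the canonical embedding ℚ → ℚ₃. -/

import Mathlib

section Z3Helpers
open Finset

theorem z3_floor (m q : ℕ) (hq : 0 < q) (h : q ≤ 1806 * m) :
    903 * m / q + 602 * m / q + 258 * m / q + 42 * m / q + m / q + (if q ≤ m then 0 else 1)
      ≤ 1806 * m / q := by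
  have key : ∀ a b : ℕ, 0 < a → a * b = 1806 → b * m / q = (1806 * m / q) / a := by
    intro a b ha hab
    rw [Nat.div_div_eq_div_mul, mul_comm q a, ← Nat.div_div_eq_div_mul, ← hab, mul_assoc,
      Nat.mul_div_cancel_left _ ha]
  have h1 := key 2 903 (by norm_num) (by norm_num)
  have h2 := key 3 602 (by norm_num) (by norm_num)
  have h3 := key 7 258 (by norm_num) (by norm_num)
  have h4 := key 43 42 (by norm_num) (by norm_num)
  have h5 := key 1806 1 (by norm_num) (by norm_num)
  rw [one_mul] at h5
  rw [h1, h2, h3, h4, h5]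
  have hM : 1 ≤ 1806 * m / q := (Nat.one_le_div_iff hq).2 h
  split_ifs with hm
  · omega
  · have : m / q = 0 := Nat.div_eq_of_lt (not_le.1 hm)
    rw [h5] at this
    omega

theorem z3_fac (m : ℕ) : ((1806 * m).choose (903 * m) * (903 * m).choose (602 * m) *
    (301 * m).choose (258 * m) * (43 * m).choose (42 * m)) *
    ((903 * m).factorial * (602 * m).factorial * (258 * m).factorial * (42 * m).factorial
      * m.factorial) = (1806 * m).factorial := by
  have h1 := Nat.choose_mul_factorial_mul_factorial (show 903 * m ≤ 1806 * m by omega)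
  have h2 := Nat.choose_mul_factorial_mul_factorial (show 602 * m ≤ 903 * m by omega)
  have h3 := Nat.choose_mul_factorial_mul_factorial (show 258 * m ≤ 301 * m by omega)
  have h4 := Nat.choose_mul_factorial_mul_factorial (show 42 * m ≤ 43 * m by omega)
  rw [show 1806 * m - 903 * m = 903 * m by omega] at h1
  rw [show 903 * m - 602 * m = 301 * m by omega] at h2
  rw [show 301 * m - 258 * m = 43 * m by omega] at h3
  rw [show 43 * m - 42 * m = m by omega] at h4
  calc _ = (1806 * m).choose (903 * m) * (903 * m).factorial * ((903 * m).choose (602 * m) *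
        (602 * m).factorial * ((301 * m).choose (258 * m) * (258 * m).factorial *
        ((43 * m).choose (42 * m) * (42 * m).factorial * m.factorial))) := by ring
    _ = _ := by rw [h4, h3, h2, h1]

theorem z3_lcm_step (m : ℕ) (hm : 0 < m) : Nat.lcmUpto (1806 * m) ∣
    ((1806 * m).choose (903 * m) * (903 * m).choose (602 * m) *
    (301 * m).choose (258 * m) * (43 * m).choose (42 * m)) * Nat.lcmUpto m := by
  have hfac := z3_fac m
  generalize ((1806 * m).choose (903 * m) * (903 * m).choose (602 * m) *
    (301 * m).choose (258 * m) * (43 * m).choose (42 * m)) = W at hfac ⊢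
  have hW0 : W ≠ 0 := by
    intro h
    rw [h, zero_mul] at hfac
    exact (Nat.factorial_ne_zero _) hfac.symm
  rw [← Nat.factorization_le_iff_dvd (Nat.lcmUpto_ne_zero _)
    (mul_ne_zero hW0 (Nat.lcmUpto_ne_zero _))]
  intro p
  by_cases hp : p.Prime
  swap
  · simp [Nat.factorization_eq_zero_of_not_prime _ hp]
  have := Fact.mk hp
  rw [Nat.factorization_mul hW0 (Nat.lcmUpto_ne_zero _), Finsupp.add_apply,
    Nat.factorization_lcmUpto _ hp, Nat.factorization_lcmUpto _ hp]
  set b := Nat.log p (1806 * m) + 1 with hb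
  have hlog : ∀ x, x ≤ 1806 * m → padicValNat p x.factorial = ∑ i ∈ Finset.Ico 1 b, x / p ^ i := by
    intro x hx
    apply padicValNat_factorial
    have := Nat.log_mono_right (b := p) hx
    omega
  have hv := congrArg (padicValNat p) hfac
  rw [padicValNat.mul hW0 (by positivity), padicValNat.mul (by positivity) (by positivity),
    padicValNat.mul (by positivity) (by positivity), padicValNat.mul (by positivity) (by positivity),
    padicValNat.mul (by positivity) (by positivity), hlog _ (by omega), hlog _ (by omega),
    hlog _ (by omega), hlog _ (by omega), hlog _ (by omega), hlog _ (by omega),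
    ← Finset.sum_add_distrib, ← Finset.sum_add_distrib, ← Finset.sum_add_distrib,
    ← Finset.sum_add_distrib] at hv
  rw [Nat.factorization_def _ hp]
  have hpt := Finset.sum_le_sum (s := Finset.Ico 1 b) (fun i hi => z3_floor m (p ^ i)
    (pow_pos hp.pos i) (by
      rw [Finset.mem_Ico] at hi
      exact Nat.pow_le_of_le_log (by omega) (by omega)))
  rw [Finset.sum_add_distrib] at hpt
  have hcount : Nat.log p (1806 * m) ≤
      ∑ i ∈ Finset.Ico 1 b, (if p ^ i ≤ m then 0 else 1) + Nat.log p m := by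
    have h1 : ∑ i ∈ Finset.Ico 1 b, (if p ^ i ≤ m then 1 else 0) ≤ Nat.log p m := by
      rw [← Finset.card_filter]
      calc _ ≤ (Finset.Ico 1 (Nat.log p m + 1)).card := by
            apply Finset.card_le_card
            intro i hi
            rw [Finset.mem_filter, Finset.mem_Ico] at hi
            rw [Finset.mem_Ico]
            have := Nat.le_log_of_pow_le hp.one_lt hi.2
            omega
        _ = _ := by simp
    have h2 : ∑ i ∈ Finset.Ico 1 b, ((if p ^ i ≤ m then 0 else 1) + (if p ^ i ≤ m then 1 else 0))
        = Nat.log p (1806 * m) := by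
      rw [Finset.sum_congr rfl (g := fun _ => 1)]
      · simp [hb]
      · intro i _; split_ifs <;> rfl
    rw [Finset.sum_add_distrib] at h2
    omega
  omega

theorem z3_choose_le (a b s t : ℕ) : (a + b).choose a * (s ^ a * t ^ b) ≤ (s + t) ^ (a + b) := by
  rw [add_pow]
  refine le_trans (le_of_eq ?_) (Finset.single_le_sum (f := fun k => s ^ k * t ^ (a + b - k) *
    ((a + b).choose k)) (fun _ _ => Nat.zero_le _) (Finset.mem_range.2 (show a < a + b + 1 by omega)))
  simp [mul_comm]

theorem z3_W_le (m : ℕ) : ((1806 * m).choose (903 * m) * (903 * m).choose (602 * m) *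
    (301 * m).choose (258 * m) * (43 * m).choose (42 * m)) * (2 ^ 602 * 6 ^ 258 * 42 ^ 42) ^ m ≤
    (2 ^ 1806 * 3 ^ 903 * 7 ^ 301 * 43 ^ 43) ^ m := by
  have h1 := z3_choose_le (903 * m) (903 * m) 1 1
  have h2 := z3_choose_le (602 * m) (301 * m) 2 1
  have h3 := z3_choose_le (258 * m) (43 * m) 6 1
  have h4 := z3_choose_le (42 * m) (m) 42 1
  rw [show 903 * m + 903 * m = 1806 * m by ring] at h1
  rw [show 602 * m + 301 * m = 903 * m by ring] at h2
  rw [show 258 * m + 43 * m = 301 * m by ring] at h3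
  rw [show 42 * m + m = 43 * m by ring] at h4
  norm_num only [one_pow, mul_one] at h1 h2 h3 h4
  have h := Nat.mul_le_mul (Nat.mul_le_mul (Nat.mul_le_mul h1 h2) h3) h4
  simp only [mul_pow, ← pow_mul]
  calc _ = _ := ?_
    _ ≤ _ := h
  ring

theorem z3_lcm_crude (m : ℕ) : (Nat.lcmUpto m : ℝ) ≤ 324 ^ m := by
  have h := Chebyshev.psi_le_const_mul_self (x := (m : ℝ)) (by positivity)
  rw [Chebyshev.psi_eq_log_lcmUpto] at h
  have hpos : (0 : ℝ) < Nat.lcmUpto m := by exact_mod_cast Nat.lcmUpto_pos m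
  rw [← Real.log_le_log_iff hpos (by positivity), Real.log_pow]
  refine h.trans ?_
  rw [mul_comm]
  apply mul_le_mul_of_nonneg_left _ (by positivity)
  have : Real.log 324 = Real.log 4 + 4 * Real.log 3 := by
    rw [show (324 : ℝ) = 4 * 3 ^ 4 by norm_num, Real.log_mul (by norm_num) (by norm_num),
      Real.log_pow]
    norm_num
  rw [this]
  have : 1 ≤ Real.log 3 := by
    rw [Real.le_log_iff_exp_le (by norm_num)]
    exact Real.exp_one_lt_three.le
  linarith

theorem z3_lcm_exists (m : ℕ) (hm : 0 < m) : ∃ W : ℕ, Nat.lcmUpto (1806 * m) ≤ W * Nat.lcmUpto m ∧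
    W * (2 ^ 602 * 6 ^ 258 * 42 ^ 42) ^ m ≤ (2 ^ 1806 * 3 ^ 903 * 7 ^ 301 * 43 ^ 43) ^ m := by
  refine ⟨_, Nat.le_of_dvd (Nat.mul_pos ?_ (Nat.lcmUpto_pos m)) (z3_lcm_step m hm), z3_W_le m⟩
  have h1 := Nat.choose_pos (show 903 * m ≤ 1806 * m by omega)
  have h2 := Nat.choose_pos (show 602 * m ≤ 903 * m by omega)
  have h3 := Nat.choose_pos (show 258 * m ≤ 301 * m by omega)
  have h4 := Nat.choose_pos (show 42 * m ≤ 43 * m by omega)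
  positivity

set_option exponentiation.threshold 4000 in
theorem z3_num : 2 * 324 * (2 ^ 1806 * 3 ^ 903 * 7 ^ 301 * 43 ^ 43) ≤
      3 ^ 1806 * (2 ^ 602 * 6 ^ 258 * 42 ^ 42) := by
  norm_num

theorem z3_final (P Q R L W U m : ℕ) (hQ : 0 < Q) (h : 2 * 324 * P ≤ R * Q)
    (h2 : W * Q ^ m ≤ P ^ m) (h1 : U ≤ W * L) (h3 : L ≤ 324 ^ m) : U * 2 ^ m ≤ R ^ m := by
  have hpos : 0 < Q ^ m := by positivity
  refine Nat.le_of_mul_le_mul_right ?_ hpos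
  calc _ ≤ (W * 324 ^ m) * 2 ^ m * Q ^ m := by
          gcongr
          exact h1.trans (Nat.mul_le_mul_left _ h3)
      _ = (W * Q ^ m) * (2 * 324) ^ m := by
          rw [mul_pow 2 324]; ring
      _ ≤ P ^ m * (2 * 324) ^ m := by gcongr
      _ = (2 * 324 * P) ^ m := by
          rw [← mul_pow, mul_comm]
      _ ≤ (R * Q) ^ m := Nat.pow_le_pow_left h m
      _ = _ := by rw [mul_pow R]

/-- `lcm(1..1806 m)` is much smaller than `3^(1806 m)`. -/
theorem z3_lcm_bound (m : ℕ) (hm : 0 < m) :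
    (Nat.lcmUpto (1806 * m)) * 2 ^ m ≤ 3 ^ (1806 * m) := by
  obtain ⟨W, h1, h2⟩ := z3_lcm_exists m hm
  have h3 := z3_lcm_crude m
  have h3' : Nat.lcmUpto m ≤ 324 ^ m := by exact_mod_cast h3
  rw [pow_mul]
  exact z3_final _ _ _ _ _ _ _ (by positivity) z3_num h2 h1 h3'

/-- The product of (3 * i + 1) (3 * i + 2) over i < m. -/
def z3p (m : ℕ) : ℕ := ∏ i ∈ range m, ((3 * i + 1) * (3 * i + 2))

def z3eps (k : ℕ) : ℚ := z3p k / (9 ^ k * (k.factorial : ℚ) ^ 2)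

def z3kap (m : ℕ) : ℚ := 9 ^ (m + 1) * (m.factorial : ℚ) ^ 2 / z3p (m + 1)

def z3S (k : ℕ) : ℚ := ∑ m ∈ range k, z3kap m / (m + 1)

def z3a (n k : ℕ) : ℚ := (n.choose k * (n + k).choose k : ℕ)

def z3X (c : ℕ → ℚ) (n : ℕ) : ℚ := ∑ k ∈ range (n + 1), (-1) ^ k * z3a n k * c k

theorem z3p_pos (m : ℕ) : 0 < z3p m := by
  unfold z3p; positivity

theorem z3p_succ (m : ℕ) : z3p (m + 1) = z3p m * ((3 * m + 1) * (3 * m + 2)) := by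
  unfold z3p; rw [prod_range_succ]

theorem z3eps_succ (k : ℕ) : ((k : ℚ) + 1) ^ 2 * z3eps (k + 1) = (k * (k + 1) + 2 / 9) * z3eps k := by
  unfold z3eps
  rw [z3p_succ, Nat.factorial_succ]
  have : (k.factorial : ℚ) ≠ 0 := by positivity
  push_cast
  field_simp
  ring

theorem z3eps_pos (k : ℕ) : 0 < z3eps k := by
  have := z3p_pos k
  unfold z3eps; positivity

theorem z3eps_kap (k : ℕ) : ((k : ℚ) + 1) ^ 2 * z3eps (k + 1) * z3kap k = 1 := by
  unfold z3eps z3kap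
  have := z3p_pos (k + 1)
  rw [Nat.factorial_succ]
  push_cast
  field_simp

theorem z3a_zero (n : ℕ) : z3a n 0 = 1 := by simp [z3a]

theorem z3a_eq_zero {n k : ℕ} (h : n < k) : z3a n k = 0 := by
  simp [z3a, Nat.choose_eq_zero_of_lt h]

theorem z3X_eq (c : ℕ → ℚ) (n N : ℕ) (h : n + 1 ≤ N) :
    z3X c n = ∑ k ∈ range N, (-1) ^ k * z3a n k * c k := by
  unfold z3X
  apply sum_subset (range_mono h)
  intro k _ hk
  rw [mem_range, not_lt] at hk
  rw [z3a_eq_zero (by omega)]; simp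

theorem z3a_diag (n k : ℕ) : ((k : ℚ) + 1) ^ 2 * z3a (n + 1) (k + 1) =
    (n + k + 1) * (n + k + 2) * z3a n k := by
  unfold z3a
  have h1 := Nat.add_one_mul_choose_eq n k
  have h2 := Nat.add_one_mul_choose_eq (n + k + 1) k
  have h3 := Nat.choose_mul_succ_eq (n + k) k
  rw [show n + k + 1 - k = n + 1 by omega] at h3
  rw [show n + 1 + (k + 1) = n + k + 1 + 1 by ring]
  have h1' : ((n : ℚ) + 1) * n.choose k = (n + 1).choose (k + 1) * (k + 1) := by exact_mod_cast h1
  have h2' : ((n : ℚ) + k + 1 + 1) * (n + k + 1).choose k =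
    (n + k + 1 + 1).choose (k + 1) * (k + 1) := by exact_mod_cast h2
  have h3' : ((n : ℚ) + k + 1) * (n + k).choose k = (n + k + 1).choose k * (n + 1) := by
    rw [mul_comm]; exact_mod_cast h3
  push_cast
  calc _ = ((n + 1).choose (k + 1) * ((k : ℚ) + 1)) * ((n + k + 1 + 1).choose (k + 1) * (k + 1)) := by
        ring
    _ = (((n : ℚ) + 1) * n.choose k) * (((n : ℚ) + k + 1 + 1) * (n + k + 1).choose k) := by
        rw [h1', h2']
    _ = n.choose k * ((n : ℚ) + k + 1 + 1) * ((n + k + 1).choose k * (n + 1)) := by ring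
    _ = _ := by rw [← h3']; ring

theorem z3a_n (n k : ℕ) : ((n : ℚ) + 1 - k) * z3a (n + 1) k = (n + 1 + k) * z3a n k := by
  rcases lt_trichotomy k (n + 1) with h | h | h
  · unfold z3a
    have h1 := Nat.choose_mul_succ_eq n k
    have h3 := Nat.choose_mul_succ_eq (n + k) k
    rw [show n + k + 1 - k = n + 1 by omega] at h3
    have h1' : (n.choose k : ℚ) * (n + 1) = (n + 1).choose k * (n + 1 - k) := by
      have := congrArg (Nat.cast (R := ℚ)) h1
      rw [Nat.cast_mul, Nat.cast_mul, Nat.cast_sub (by omega)] at this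
      exact_mod_cast this
    have h3' : ((n + k).choose k : ℚ) * (n + k + 1) = (n + k + 1).choose k * (n + 1) := by
      exact_mod_cast h3
    rw [show n + 1 + k = n + k + 1 by ring]
    push_cast
    have hn : (n : ℚ) + 1 ≠ 0 := by positivity
    apply mul_left_cancel₀ hn
    linear_combination (-((n + k + 1).choose k : ℚ)) * (n + 1) * h1' -
      (n.choose k : ℚ) * (n + 1) * h3'
  · subst h; rw [z3a_eq_zero (show n < n + 1 by omega)]; push_cast; ring
  · rw [z3a_eq_zero h, z3a_eq_zero (show n < k by omega)]; ring

theorem z3a_k (n k : ℕ) : ((k : ℚ) + 1) ^ 2 * z3a n (k + 1) = (n - k) * (n + k + 1) * z3a n k := by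
  have h1 := z3a_diag n k
  have h2 := z3a_n n (k + 1)
  push_cast at h2
  have : ((n : ℚ) + 1 + (k + 1)) ≠ 0 := by positivity
  apply mul_left_cancel₀ this
  linear_combination (-((k : ℚ) + 1) ^ 2) * h2 + ((n : ℚ) - k) * h1

theorem z3a_rec (n k : ℕ) : ((n : ℚ) + 2) ^ 3 * (z3a (n + 2) (k + 1) - z3a (n + 1) (k + 1)) -
    (n + 1) ^ 3 * (z3a (n + 1) (k + 1) - z3a n (k + 1)) =
    2 * (2 * n + 3) * ((k + 1) ^ 2 * z3a (n + 1) k + (k + 1) * (k + 2) * z3a (n + 1) (k + 1)) := by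
  have h1 := z3a_diag (n + 1) k
  have h2 := z3a_k (n + 1) k
  have h3 := z3a_k n k
  have h4 := z3a_n n k
  push_cast at h1 h2
  have : ((k : ℚ) + 1) ^ 2 ≠ 0 := by positivity
  apply mul_left_cancel₀ this
  linear_combination ((n : ℚ) + 2) ^ 3 * h1 + (-(((n : ℚ) + 2) ^ 3) - (n + 1) ^ 3 -
    2 * (2 * n + 3) * (k + 1) * (k + 2)) * h2 + ((n : ℚ) + 1) ^ 3 * h3 - ((n : ℚ) + 1) ^ 3 * (n - k) * h4

theorem z3X_rec (c : ℕ → ℚ) (n : ℕ) :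
    ((n : ℚ) + 2) ^ 3 * (z3X c (n + 2) - z3X c (n + 1)) - (n + 1) ^ 3 * (z3X c (n + 1) - z3X c n) =
    2 * (2 * n + 3) * z3X (fun k => k * (k + 1) * c k - (k + 1) ^ 2 * c (k + 1)) (n + 1) := by
  rw [z3X_eq c n (n + 3) (by omega), z3X_eq c (n + 1) (n + 3) (by omega), z3X_eq c (n + 2) (n + 3) (by omega)]
  have e1 : z3X (fun k => k * (k + 1) * c k - (k + 1) ^ 2 * c (k + 1)) (n + 1) =
      ∑ k ∈ range (n + 2), (-1) ^ (k + 1) * c (k + 1) * ((k + 1) ^ 2 * z3a (n + 1) k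
        + (k + 1) * (k + 2) * z3a (n + 1) (k + 1)) := by
    have h1 : ∑ k ∈ range (n + 2), (-1) ^ (k + 1) * c (k + 1) * ((k + 1) ^ 2 * z3a (n + 1) k
        + (k + 1) * (k + 2) * z3a (n + 1) (k + 1)) = 
        ∑ k ∈ range (n + 2), (-1) ^ (k + 1) * c (k + 1) * ((k + 1) ^ 2 * z3a (n + 1) k) + 
        ∑ k ∈ range (n + 2), (fun k : ℕ => (-1) ^ k * c k * (k * (k + 1) * z3a (n + 1) k)) (k + 1) := by
      rw [← sum_add_distrib]
      apply sum_congr rfl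
      intro k _
      push_cast
      ring
    have h2 := sum_range_succ' (fun k : ℕ => (-1) ^ k * c k * (k * (k + 1) * z3a (n + 1) k)) (n + 2)
    rw [sum_range_succ, z3a_eq_zero (show n + 1 < n + 2 by omega)] at h2
    rw [h1]
    simp only [Nat.cast_zero, zero_mul, mul_zero, add_zero] at h2
    rw [← h2, z3X, ← sum_add_distrib]
    apply sum_congr rfl
    intro k _
    ring
  rw [e1, mul_sum]
  rw [sum_range_succ' _ (n + 2), sum_range_succ' _ (n + 2), sum_range_succ' _ (n + 2)]
  simp only [z3a_zero]
  have : ∀ x y w u : ℚ, ((n : ℚ) + 2) ^ 3 * (x + u - (y + u)) - (n + 1) ^ 3 * (y + u - (w + u)) =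
    ((n : ℚ) + 2) ^ 3 * (x - y) - (n + 1) ^ 3 * (y - w) := by intros; ring
  rw [this, ← sum_sub_distrib, ← sum_sub_distrib, mul_sum, mul_sum, ← sum_sub_distrib]
  apply sum_congr rfl
  intro k _
  linear_combination (-1) ^ (k + 1) * c (k + 1) * z3a_rec n k

/-- `∑ (-1)^k a(n,k) = (-1)^n` -/
theorem z3_alt (n : ℕ) : z3X (fun _ => 1) n = (-1) ^ n := by
  have h := Polynomial.shiftedLegendre_eval_symm n (1 : ℚ)
  rw [sub_self, Polynomial.aeval_eq_sum_range, Polynomial.natDegree_shiftedLegendre,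
    Polynomial.aeval_eq_sum_range, Polynomial.natDegree_shiftedLegendre] at h
  simp only [Polynomial.coeff_shiftedLegendre] at h
  rw [sum_range_succ' (fun i => ((-1 : ℤ) ^ i * (n.choose i) * ((n + i).choose n)) • (0 : ℚ) ^ i)] at h
  simp only [one_pow] at h
  unfold z3X z3a
  simp at h
  rw [← h]
  apply sum_congr rfl
  intro k _
  rw [← Nat.choose_symm (show n ≤ n + k by omega), show n + k - n = k by omega]
  push_cast
  ring

def z3F (n m : ℕ) : ℚ := z3X (fun k => 1 / (m + 1 + k)) n

theorem z3F_zero (m : ℕ) : z3F 0 m = 1 / (m + 1) := by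
  simp [z3F, z3X, z3a]

theorem z3F_succ (n m : ℕ) : ((n : ℚ) + m + 2) * z3F (n + 1) m = (n - m) * z3F n m := by
  have h1 := z3_alt n
  have h2 := z3_alt (n + 1)
  unfold z3F
  rw [z3X_eq _ n (n + 2) (by omega)] at h1 ⊢
  unfold z3X at *
  have e1 : ((n : ℚ) + m + 2) * ∑ k ∈ range (n + 1 + 1), (-1) ^ k * z3a (n + 1) k * (1 / ((m : ℚ) + 1 + k))
    - ∑ k ∈ range (n + 1 + 1), (-1) ^ k * z3a (n + 1) k * 1 =
    (n - m) * ∑ k ∈ range (n + 2), (-1) ^ k * z3a n k * (1 / ((m : ℚ) + 1 + k)) +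
      ∑ k ∈ range (n + 2), (-1) ^ k * z3a n k * 1 := by
    rw [mul_sum, mul_sum, ← sum_sub_distrib, ← sum_add_distrib]
    apply sum_congr rfl
    intro k _
    have h := z3a_n n k
    have : (m : ℚ) + 1 + k ≠ 0 := by positivity
    field_simp
    linear_combination h
  rw [h1, h2] at e1
  rw [pow_succ] at e1
  linarith

theorem z3F_lt (n m : ℕ) (h : m < n) : z3F n m = 0 := by
  induction n with
  | zero => omega
  | succ n ih =>
    have h1 := z3F_succ n m
    have h2 : (n : ℚ) + m + 2 ≠ 0 := by positivity
    apply mul_left_cancel₀ h2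
    rw [h1, mul_zero]
    rcases Nat.lt_succ_iff_lt_or_eq.1 h with h | h
    · rw [ih h, mul_zero]
    · rw [h, sub_self, zero_mul]

theorem z3F_eq (n r : ℕ) : z3F n (n + r) * (r.factorial * (2 * n + r + 1).factorial) =
    (-1) ^ n * ((n + r).factorial : ℚ) ^ 2 := by
  induction n generalizing r with
  | zero =>
    rw [z3F_zero, mul_zero, zero_add, Nat.factorial_succ]
    push_cast
    field_simp
  | succ n ih =>
    have h1 := z3F_succ n (n + 1 + r)
    have h2 := ih (r + 1)
    rw [show n + (r + 1) = n + 1 + r by ring, show 2 * n + (r + 1) + 1 = 2 * n + r + 2 by ring] at h2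
    rw [show 2 * (n + 1) + r + 1 = 2 * n + r + 2 + 1 by ring, Nat.factorial_succ (2 * n + r + 2), pow_succ,
      ]
    rw [Nat.factorial_succ r] at h2
    push_cast at h1 h2 ⊢
    linear_combination (r.factorial : ℚ) * ((2 * n + r + 2).factorial) * h1 - h2

def z3A : ℕ → ℚ := z3X z3eps
def z3B : ℕ → ℚ := z3X (fun k => z3eps k * z3S k)

theorem z3X_smul (c : ℕ → ℚ) (t : ℚ) (n : ℕ) : z3X (fun k => t * c k) n = t * z3X c n := by
  unfold z3X
  rw [mul_sum]
  exact sum_congr rfl fun _ _ => by ring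

theorem z3X_sub (c d : ℕ → ℚ) (n : ℕ) : z3X (fun k => c k - d k) n = z3X c n - z3X d n := by
  unfold z3X
  rw [← sum_sub_distrib]
  exact sum_congr rfl fun _ _ => by ring

theorem z3A_rec (n : ℕ) :
    ((n : ℚ) + 2) ^ 3 * (z3A (n + 2) - z3A (n + 1)) - (n + 1) ^ 3 * (z3A (n + 1) - z3A n) =
    2 * (2 * n + 3) * (- (2 / 9) * z3A (n + 1)) := by
  unfold z3A
  rw [z3X_rec, ← z3X_smul z3eps]
  congr 2
  funext k
  rw [z3eps_succ]; ring

theorem z3B_rec (n : ℕ) :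
    ((n : ℚ) + 2) ^ 3 * (z3B (n + 2) - z3B (n + 1)) - (n + 1) ^ 3 * (z3B (n + 1) - z3B n) =
    2 * (2 * n + 3) * (- (2 / 9) * z3B (n + 1)) := by
  have h0 := z3F_lt (n + 1) 0 (by omega)
  unfold z3F at h0
  unfold z3B
  rw [z3X_rec, ← z3X_smul (fun k => z3eps k * z3S k)]
  have : (fun k : ℕ => (k : ℚ) * (k + 1) * (z3eps k * z3S k) - (k + 1) ^ 2 * (z3eps (k + 1) * z3S (k + 1)))
    = fun k : ℕ => (fun k => (-(2 / 9) * (z3eps k * z3S k))) k - (fun k : ℕ => 1 / (((0 : ℕ) : ℚ) + 1 + k)) k := by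
    funext k
    have h1 := z3eps_succ k
    have h2 := z3eps_kap k
    have h3 : z3S (k + 1) = z3S k + z3kap k / (k + 1) := by unfold z3S; rw [sum_range_succ]
    rw [h3]
    have : (k : ℚ) + 1 ≠ 0 := by positivity
    push_cast
    field_simp
    simp only [zero_add]
    linear_combination (-9 * ((k : ℚ) + 1)) * z3S k * h1 - 9 * h2
  rw [this, z3X_sub, h0, sub_zero]

theorem z3_growth (x : ℕ → ℚ) (C : ℚ) (h0 : |x 0| ≤ C) (h1 : |x 1 - x 0| ≤ C)
    (hrec : ∀ n : ℕ, ((n : ℚ) + 2) ^ 3 * (x (n + 2) - x (n + 1)) - (n + 1) ^ 3 * (x (n + 1) - x n) =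
    2 * (2 * n + 3) * (- (2 / 9) * x (n + 1))) (n : ℕ) :
    |x n| ≤ C * (n + 1) ∧ |x (n + 1) - x n| ≤ C := by
  induction n with
  | zero => simpa using ⟨h0, h1⟩
  | succ n ih =>
    obtain ⟨ha, hb⟩ := ih
    have hC : 0 ≤ C := (abs_nonneg _).trans h0
    have hx : |x (n + 1)| ≤ C * (n + 2) := by
      have := abs_add_le (x (n + 1) - x n) (x n)
      rw [sub_add_cancel] at this
      linarith
    refine ⟨by push_cast; linarith, ?_⟩
    have h := hrec n
    have hp : (0 : ℚ) < ((n : ℚ) + 2) ^ 3 := by positivity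
    rw [abs_le] at hb hx ⊢
    have hn : (0 : ℚ) ≤ n := by positivity
    have e1 : ((n : ℚ) + 1) ^ 3 * C + (4 / 9) * (2 * n + 3) * (C * (n + 2)) ≤ ((n : ℚ) + 2) ^ 3 * C := by
      nlinarith [mul_nonneg hC hn, mul_nonneg hC (mul_nonneg hn hn)]
    have e2 := mul_le_mul_of_nonneg_left hb.1 (show 0 ≤ ((n : ℚ) + 1) ^ 3 by positivity)
    have e3 := mul_le_mul_of_nonneg_left hb.2 (show 0 ≤ ((n : ℚ) + 1) ^ 3 by positivity)
    have e4 := mul_le_mul_of_nonneg_left hx.1 (show 0 ≤ (4 / 9) * (2 * (n : ℚ) + 3) by positivity)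
    have e5 := mul_le_mul_of_nonneg_left hx.2 (show 0 ≤ (4 / 9) * (2 * (n : ℚ) + 3) by positivity)
    constructor
    · apply le_of_mul_le_mul_left _ hp
      linarith
    · apply le_of_mul_le_mul_left _ hp
      linarith

theorem z3A_bound (n : ℕ) : |z3A n| ≤ n + 1 := by
  have h0 : z3A 0 = 1 := by simp [z3A, z3X, z3a, z3eps, z3p]
  have h1 : z3A 1 = 5 / 9 := by simp [z3A, z3X, z3a, z3eps, z3p, sum_range_succ]; norm_num
  have := (z3_growth z3A 1 (by rw [h0]; norm_num) (by rw [h0, h1, abs_le]; norm_num) z3A_rec n).1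
  linarith

theorem z3B_bound (n : ℕ) : |z3B n| ≤ 2 * (n + 1) := by
  have h0 : z3B 0 = 0 := by simp [z3B, z3X, z3S]
  have h1 : z3B 1 = -2 := by
    simp [z3B, z3X, z3a, z3eps, z3p, z3S, z3kap, sum_range_succ]
  exact (z3_growth z3B 2 (by rw [h0]; norm_num) (by rw [h0, h1, abs_le]; norm_num) z3B_rec n).1

theorem z3_dvd_aux (M u j c r : ℕ) (hu : (3 * u : ZMod M) = 1) (hM : M ∣ r.factorial) :
    M ∣ ∏ i ∈ range r, (3 * (j + i) + c) := by
  have h1 : M ∣ (j + u * c).ascFactorial r := hM.trans (Nat.factorial_dvd_ascFactorial _ _)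
  rw [Nat.ascFactorial_eq_prod_range] at h1
  rw [← ZMod.natCast_eq_zero_iff] at h1 ⊢
  have : ((∏ i ∈ range r, (3 * (j + i) + c) : ℕ) : ZMod M) =
      3 ^ r * ((∏ i ∈ range r, (j + u * c + i) : ℕ) : ZMod M) := by
    push_cast
    rw [← card_range r, ← prod_const, card_range, ← prod_mul_distrib]
    apply prod_congr rfl
    intro i _
    linear_combination (-(c : ZMod M)) * hu
  rw [this, h1, mul_zero]

theorem z3_dvd (j r : ℕ) : r.factorial ^ 2 ∣
    3 ^ r * ∏ i ∈ range r, ((3 * (j + i) + 1) * (3 * (j + i) + 2)) := by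
  obtain ⟨v, M, hM, hrM⟩ := Nat.exists_eq_pow_mul_and_not_dvd (Nat.factorial_ne_zero r) 3 (by norm_num)
  have hcop : Nat.Coprime 3 M := (Nat.Prime.coprime_iff_not_dvd Nat.prime_three).2 hM
  have hv : 2 * v ≤ r := by
    have h1 := sub_one_mul_padicValNat_factorial (p := 3) r
    have h2 : padicValNat 3 r.factorial = v := by
      rw [hrM, padicValNat.mul (by positivity) (by rintro rfl; simp at hM), padicValNat.prime_pow,
        padicValNat.eq_zero_of_not_dvd hM, add_zero]
    rw [h2] at h1
    omega
  have hu : (3 * (((3 : ZMod M)⁻¹).val : ℕ) : ZMod M) = 1 := by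
    have hM0 : NeZero M := ⟨by rintro rfl; simp at hM⟩
    rw [ZMod.natCast_zmod_val]
    exact ZMod.coe_mul_inv_eq_one 3 hcop
  have hd : M ∣ r.factorial := by rw [hrM]; exact dvd_mul_left _ _
  rw [prod_mul_distrib]
  have h1 := z3_dvd_aux M _ j 1 r hu hd
  have h2 := z3_dvd_aux M _ j 2 r hu hd
  rw [hrM, mul_pow, ← pow_mul, mul_comm v 2, pow_two M]
  exact mul_dvd_mul (pow_dvd_pow _ hv) (mul_dvd_mul h1 h2)

theorem z3p_add (j r : ℕ) : z3p (j + r) = z3p j *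
    ∏ i ∈ range r, ((3 * (j + i) + 1) * (3 * (j + i) + 2)) := by
  unfold z3p; rw [prod_range_add]

theorem z3eps_int (j r : ℕ) : ∃ t : ℕ, 27 ^ r * ((j + r).choose j : ℚ) ^ 2 * z3eps (j + r) =
    t * z3eps j := by
  obtain ⟨t, ht⟩ := z3_dvd j r
  refine ⟨t, ?_⟩
  have hc := Nat.add_choose_mul_factorial_mul_factorial j r
  rw [← Nat.choose_symm_add] at hc
  have hc' : ((j + r).choose j : ℚ) * j.factorial * r.factorial = (j + r).factorial := by
    exact_mod_cast hc
  have ht' : (3 : ℚ) ^ r * (∏ i ∈ range r, ((3 * (j + i) + 1) * (3 * (j + i) + 2)) : ℕ) =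
    (r.factorial : ℚ) ^ 2 * t := by exact_mod_cast ht
  unfold z3eps
  rw [z3p_add, ← hc', Nat.cast_mul, pow_add]
  generalize ((∏ i ∈ range r, ((3 * (j + i) + 1) * (3 * (j + i) + 2)) : ℕ) : ℚ) = P at ht'
  have hch : ((j + r).choose j : ℚ) ≠ 0 := by
    exact_mod_cast (Nat.choose_pos (show j ≤ j + r by omega)).ne'
  have hf : (r.factorial : ℚ) ≠ 0 := by positivity
  rw [show (27 : ℚ) ^ r = 3 ^ r * 9 ^ r by rw [← mul_pow]; norm_num]
  field_simp
  linear_combination (z3p j : ℚ) * ht'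

theorem z3_leib (D : ℕ) (j k : ℕ) (hD : ∀ i, 1 ≤ i → i ≤ k → i ∣ D) (hj : j < k) :
    ∃ t : ℤ, (D : ℚ) = t * ((j + 1) * k.choose (j + 1)) := by
  induction j generalizing k with
  | zero =>
    obtain ⟨t, ht⟩ := hD k (by omega) le_rfl
    exact ⟨t, by rw [ht]; push_cast; simp; ring⟩
  | succ j ih =>
    obtain ⟨k, rfl⟩ : ∃ k', k = k' + 1 := ⟨k - 1, by omega⟩
    obtain ⟨t1, h1⟩ := ih k (fun i a b => hD i a (by omega)) (by omega)
    obtain ⟨t2, h2⟩ := ih (k + 1) hD (by omega)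
    refine ⟨t1 - t2, ?_⟩
    have e1 := Nat.choose_mul_succ_eq k (j + 1)
    have e2 := Nat.add_one_mul_choose_eq k (j + 1)
    rw [show k + 1 - (j + 1) = k - j by omega] at e1
    have e1' : (k.choose (j + 1) : ℚ) * (k + 1) = (k + 1).choose (j + 1) * (k - j) := by
      have := congrArg (Nat.cast (R := ℚ)) e1
      rw [Nat.cast_mul, Nat.cast_mul, Nat.cast_sub (by omega)] at this
      exact_mod_cast this
    have e2' : ((k : ℚ) + 1) * k.choose (j + 1) = (k + 1).choose (j + 1 + 1) * (j + 1 + 1) := by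
      exact_mod_cast e2
    push_cast
    have hj1 : (j : ℚ) + 1 ≠ 0 := by positivity
    apply mul_left_cancel₀ hj1
    linear_combination ((k : ℚ) + 1) * h1 - ((k : ℚ) - j) * h2 + ((j : ℚ) + 1) * (t1 - t2) * e2' +
      (t2 : ℚ) * (j + 1) * e1'

theorem z3A_int (n : ℕ) : 27 ^ n * z3A n ∈ (Int.castRingHom ℚ).range := by
  unfold z3A z3X
  rw [mul_sum]
  apply Subring.sum_mem
  intro k hk
  rw [mem_range] at hk
  obtain ⟨t, ht⟩ := z3eps_int 0 k
  have he : z3eps 0 = 1 := by simp [z3eps, z3p]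
  rw [zero_add, he, Nat.choose_zero_right] at ht
  refine ⟨27 ^ (n - k) * ((-1) ^ k * (n.choose k * (n + k).choose k : ℕ) * t), ?_⟩
  have : (27 : ℚ) ^ n = 27 ^ (n - k) * 27 ^ k := by rw [← pow_add]; congr 1; omega
  rw [this]
  unfold z3a
  simp only [eq_intCast]
  push_cast at ht ⊢
  linear_combination (-(27 : ℚ) ^ (n - k) * ((-1) ^ k * (n.choose k * (n + k).choose k))) * ht

theorem z3B_int (n D : ℕ) (hD : ∀ i, 1 ≤ i → i ≤ n → i ∣ D) :
    27 ^ n * (D : ℚ) ^ 3 * z3B n ∈ (Int.castRingHom ℚ).range := by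
  unfold z3B z3X z3S
  rw [mul_sum]
  apply Subring.sum_mem
  intro k hk
  rw [mem_range] at hk
  beta_reduce
  rw [mul_sum, mul_sum, mul_sum]
  apply Subring.sum_mem
  intro m hm
  rw [mem_range] at hm
  obtain ⟨r, rfl⟩ : ∃ r, k = m + 1 + r := ⟨k - (m + 1), by omega⟩
  obtain ⟨t, ht⟩ := z3eps_int (m + 1) r
  obtain ⟨u, hu⟩ := z3_leib D m (m + 1 + r) (fun i a b => hD i a (by omega)) (by omega)
  obtain ⟨w, hw⟩ := hD (m + 1) (by omega) (by omega)
  have hk := z3eps_kap m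
  refine ⟨27 ^ (n - r) * ((-1) ^ (m + 1 + r) * (n.choose (m + 1 + r) *
    (n + (m + 1 + r)).choose (m + 1 + r) : ℕ) * (t * u ^ 2 * w)), ?_⟩
  have : (27 : ℚ) ^ n = 27 ^ (n - r) * 27 ^ r := by rw [← pow_add]; congr 1; omega
  rw [this]
  unfold z3a
  simp only [eq_intCast]
  have hw' : (D : ℚ) = (m + 1) * w := by rw [hw]; push_cast; ring
  have hD3 : (D : ℚ) ^ 3 = (u * ((m + 1) * (m + 1 + r).choose (m + 1))) ^ 2 * ((m + 1) * w) := by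
    rw [← hu, ← hw']; ring
  rw [hD3]
  have hm1 : (m : ℚ) + 1 ≠ 0 := by positivity
  push_cast
  field_simp
  have h5 : (27 : ℚ) ^ r * ((m + 1 + r).choose (m + 1)) ^ 2 * z3eps (m + 1 + r) * (m + 1) ^ 2 * z3kap m = t := by
    rw [ht]; linear_combination (t : ℚ) * hk
  rw [← h5]
  ring

/-! ### 3-adic estimates -/

theorem z3_three_norm : ‖(3 : ℚ_[3])‖ = 1 / 3 := by
  have := Padic.norm_p (p := 3)
  norm_num at this ⊢
  exact this

theorem z3_nine_norm : ‖(9 : ℚ_[3])‖ = 1 / 9 := by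
  rw [show (9 : ℚ_[3]) = 3 ^ 2 by norm_num, norm_pow, z3_three_norm]; norm_num

theorem z3p_norm (m : ℕ) : ‖(z3p m : ℚ_[3])‖ = 1 := by
  rw [Padic.norm_natCast_eq_one_iff]
  unfold z3p
  apply Nat.Coprime.prod_right
  intro i _
  apply Nat.Coprime.mul_right <;>
  · rw [Nat.Prime.coprime_iff_not_dvd Nat.prime_three]; omega

theorem z3_nat_le_one (n : ℕ) : ‖(n : ℚ_[3])‖ ≤ 1 := by
  exact_mod_cast Padic.norm_int_le_one (p := 3) n

theorem z3_nat_eq {n : ℕ} (hn : n ≠ 0) : ‖(n : ℚ_[3])‖ = ((3 : ℝ) ^ (padicValNat 3 n))⁻¹ := by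
  rw [Padic.norm_eq_zpow_neg_valuation (by exact_mod_cast hn), Padic.valuation_natCast]
  simp

theorem z3_nat_ge {n : ℕ} (hn : n ≠ 0) : ‖(n : ℚ_[3])‖⁻¹ ≤ n := by
  rw [z3_nat_eq hn, inv_inv]
  exact_mod_cast Nat.le_of_dvd (by omega) pow_padicValNat_dvd

theorem z3_nat_pos {n : ℕ} (hn : n ≠ 0) : 0 < ‖(n : ℚ_[3])‖ := by
  rw [norm_pos_iff]; exact_mod_cast hn

theorem z3kap_norm (m : ℕ) : ‖(z3kap m : ℚ_[3])‖ =
    (1 / 9) ^ (m + 1) * ‖(m.factorial : ℚ_[3])‖ ^ 2 := by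
  unfold z3kap
  push_cast
  rw [norm_div, norm_mul, norm_pow, norm_pow, z3p_norm, z3_nine_norm, div_one]

theorem z3kap_le (m : ℕ) : ‖(z3kap m : ℚ_[3])‖ ≤ (1 / 9) ^ (m + 1) := by
  rw [z3kap_norm]
  have h := z3_nat_le_one m.factorial
  have : ‖(m.factorial : ℚ_[3])‖ ^ 2 ≤ 1 := pow_le_one₀ (norm_nonneg _) h
  nlinarith [show (0:ℝ) < (1 / 9) ^ (m + 1) by positivity]

theorem z3_tsum_norm_le (f : ℕ → ℚ_[3]) (hf : Summable f) (C : ℝ) (hC : 0 ≤ C) (h : ∀ i, ‖f i‖ ≤ C) :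
    ‖∑' i, f i‖ ≤ C := by
  have h1 := hf.hasSum.tendsto_sum_nat.norm
  refine le_of_tendsto h1 (Filter.Eventually.of_forall fun N => ?_)
  exact IsUltrametricDist.norm_sum_le_of_forall_le_of_nonneg hC fun i _ => h i

theorem z3_bound_summable (k : ℕ) : Summable (fun m : ℕ => (1 / 9 : ℝ) ^ (m + 1) * (k + m + 1)) := by
  have h1 := summable_pow_mul_geometric_of_norm_lt_one (R := ℝ) 1 (r := 1 / 9) (by norm_num)
  have h0 := summable_geometric_of_norm_lt_one (K := ℝ) (x := 1 / 9) (by norm_num)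
  refine ((h1.mul_left (1 / 9)).add (h0.mul_left ((1 / 9 : ℝ) * (k + 1)))).congr fun m => ?_
  ring

noncomputable def z3T (k : ℕ) : ℚ_[3] := ∑' m : ℕ, ((z3kap m / (k + m + 1) : ℚ) : ℚ_[3])

theorem z3T_term_le (k m : ℕ) : ‖((z3kap m / (k + m + 1) : ℚ) : ℚ_[3])‖ ≤
    (1 / 9 : ℝ) ^ (m + 1) * (k + m + 1) := by
  push_cast
  rw [norm_div, div_eq_mul_inv]
  have := z3_nat_ge (n := k + m + 1) (by omega)
  push_cast at this
  exact mul_le_mul (z3kap_le m) this (by positivity) (by positivity)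

theorem z3T_summable (k : ℕ) : Summable fun m : ℕ => ((z3kap m / (k + m + 1) : ℚ) : ℚ_[3]) :=
  Summable.of_norm_bounded (z3_bound_summable k) (z3T_term_le k)

theorem z3kap_succ (m : ℕ) : z3kap (m + 1) * ((m + 1) * (m + 2) + 2 / 9) = ((m : ℚ) + 1) ^ 2 * z3kap m := by
  unfold z3kap
  have := z3p_pos (m + 1)
  rw [z3p_succ (m + 1), Nat.factorial_succ]
  push_cast
  field_simp
  ring

theorem z3T_partial (k N : ℕ) : ((k : ℚ) + 1) ^ 2 * ∑ m ∈ range N, z3kap m / ((k + 1 : ℕ) + m + 1) -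
    (k * (k + 1) + 2 / 9) * ∑ m ∈ range N, z3kap m / (k + m + 1) =
    (N * (N + 1) + 2 / 9) * (z3kap N / (k + N + 1)) - 1 / (k + 1) := by
  induction N with
  | zero =>
    have : z3kap 0 = 9 / 2 := by norm_num [z3kap, z3p]
    rw [this]; simp; field_simp; ring
  | succ N ih =>
    rw [sum_range_succ, sum_range_succ, mul_add, mul_add]
    have h := z3kap_succ N
    have e : (((N + 1 : ℕ) : ℚ) * ((N + 1 : ℕ) + 1) + 2 / 9) * (z3kap (N + 1) / (k + (N + 1 : ℕ) + 1)) =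
      ((N : ℚ) + 1) ^ 2 * z3kap N / (k + N + 2) := by
      rw [← h]; push_cast; ring
    rw [e]
    have : ∀ a b c d : ℚ, a - b = c → a + d - b = c + d := by intros; linarith
    push_cast at ih ⊢
    have e2 : ((k : ℚ) + 1) ^ 2 * (z3kap N / (k + 1 + N + 1)) - (k * (k + 1) + 2 / 9) * (z3kap N / (k + N + 1)) =
      ((N : ℚ) + 1) ^ 2 * z3kap N / (k + N + 2) - (N * (N + 1) + 2 / 9) * (z3kap N / (k + N + 1)) := by
      rw [show (k : ℚ) + 1 + N + 1 = k + N + 2 by ring]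
      have h1 : (k : ℚ) + N + 1 ≠ 0 := by positivity
      have h2 : (k : ℚ) + N + 2 ≠ 0 := by positivity
      field_simp
      ring
    linear_combination ih + e2

theorem z3T_rec (k : ℕ) : ((k : ℚ_[3]) + 1) ^ 2 * z3T (k + 1) =
    (k * (k + 1) + 2 / 9) * z3T k - 1 / (k + 1) := by
  have h1 := (z3T_summable (k + 1)).hasSum.tendsto_sum_nat
  have h0 := (z3T_summable k).hasSum.tendsto_sum_nat
  have h2 := (h1.const_mul (((k : ℚ_[3]) + 1) ^ 2)).sub (h0.const_mul ((k : ℚ_[3]) * (k + 1) + 2 / 9))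
  have h3 : Filter.Tendsto (fun N : ℕ => ((((N : ℚ) * (N + 1) + 2 / 9) * (z3kap N / (k + N + 1)) - 1 / (k + 1) : ℚ) : ℚ_[3]))
      Filter.atTop (nhds (0 - 1 / ((k : ℚ_[3]) + 1))) := by
    push_cast
    apply Filter.Tendsto.sub_const
    rw [tendsto_zero_iff_norm_tendsto_zero]
    have h4 := (z3_bound_summable k).tendsto_atTop_zero.const_mul 9
    rw [mul_zero] at h4
    refine squeeze_zero (fun _ => norm_nonneg _) (fun N => ?_) h4
    have := z3T_term_le k N
    push_cast at this
    rw [norm_mul]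
    refine mul_le_mul ?_ this (norm_nonneg _) (by norm_num)
    refine (Padic.nonarchimedean _ _).trans (max_le ?_ ?_)
    · have := z3_nat_le_one (N * (N + 1))
      push_cast at this
      linarith
    · rw [norm_div, z3_nine_norm]
      have := z3_nat_le_one 2
      push_cast at this
      linarith
  have h5 := tendsto_nhds_unique (h3.congr fun N => ?_) h2
  · unfold z3T
    linear_combination -h5
  · rw [← z3T_partial]
    push_cast
    rfl

theorem z3T_eq (k : ℕ) : (z3eps k : ℚ_[3]) * (z3T 0 - (z3S k : ℚ_[3])) = z3T k := by
  induction k with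
  | zero =>
    have : z3eps 0 = 1 := by simp [z3eps, z3p]
    rw [this]; simp [z3S]
  | succ k ih =>
    have hk : ((k : ℚ_[3]) + 1) ≠ 0 := by exact_mod_cast Nat.succ_ne_zero k
    apply mul_left_cancel₀ (pow_ne_zero 2 hk)
    rw [z3T_rec, ← ih]
    have hs : z3S (k + 1) = z3S k + z3kap k / (k + 1) := by unfold z3S; rw [sum_range_succ]
    have e1 := congrArg (Rat.cast (K := ℚ_[3])) (z3eps_succ k)
    have e2 := congrArg (Rat.cast (K := ℚ_[3])) (z3eps_kap k)
    rw [hs]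
    push_cast at e1 e2 ⊢
    rw [← mul_assoc, ← mul_assoc, ← e1]
    field_simp
    linear_combination (-1 : ℚ_[3]) * e2

theorem z3R_eq (n : ℕ) : (z3A n : ℚ_[3]) * z3T 0 - z3B n =
    ∑' m : ℕ, ((z3kap m * z3F n m : ℚ) : ℚ_[3]) := by
  have h1 : (z3A n : ℚ_[3]) * z3T 0 - z3B n = ∑ k ∈ range (n + 1), ((-1) ^ k * (z3a n k : ℚ_[3])) * z3T k := by
    unfold z3A z3B z3X
    push_cast
    rw [sum_mul, ← sum_sub_distrib]
    apply sum_congr rfl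
    intro k _
    rw [← z3T_eq k]; ring
  rw [h1]
  unfold z3T
  simp_rw [← tsum_mul_left]
  rw [← Summable.tsum_finsetSum (fun k _ => (z3T_summable k).mul_left _)]
  congr 1
  ext m
  unfold z3F z3X
  push_cast
  rw [mul_sum]
  apply sum_congr rfl
  intro k _
  ring

theorem z3R_summable (n : ℕ) : Summable fun m : ℕ => ((z3kap m * z3F n m : ℚ) : ℚ_[3]) := by
  have := summable_sum (s := range (n + 1)) (f := fun k m => ((-1) ^ k * (z3a n k : ℚ_[3])) *
    ((z3kap m / (k + m + 1) : ℚ) : ℚ_[3])) (fun k _ => (z3T_summable k).mul_left _)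
  refine this.congr fun m => ?_
  unfold z3F z3X
  push_cast
  rw [mul_sum]
  apply sum_congr rfl
  intro k _
  ring

theorem z3_norm_shift (a N i : ℕ) (hN : 3 ^ a ∣ N) (hi : 0 < i) (hia : i < 3 ^ a) :
    ‖((N + i : ℕ) : ℚ_[3])‖ = ‖(i : ℚ_[3])‖ := by
  have h1 : ‖(N : ℚ_[3])‖ ≤ (3 : ℝ) ^ (-a : ℤ) := by
    have := (Padic.norm_int_le_pow_iff_dvd (p := 3) N a).2 (by exact_mod_cast hN)
    exact_mod_cast this
  have h2 : ¬ ‖(i : ℚ_[3])‖ ≤ (3 : ℝ) ^ (-a : ℤ) := by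
    intro h
    have := (Padic.norm_int_le_pow_iff_dvd (p := 3) i a).1 (by exact_mod_cast h)
    have h3 : 3 ^ a ∣ i := by exact_mod_cast this
    exact absurd (Nat.le_of_dvd hi h3) (by omega)
  have h3 : ‖(N : ℚ_[3])‖ < ‖(i : ℚ_[3])‖ := by linarith
  push_cast
  rw [Padic.add_eq_max_of_ne h3.ne, max_eq_right h3.le]

theorem z3_choose_norm_small (a N r : ℕ) (hN : 3 ^ a ∣ N) (hr : r + 1 < 3 ^ a) :
    ‖(((N + 1 + r).choose r : ℕ) : ℚ_[3])‖⁻¹ ≤ r + 1 := by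
  have h1 := Nat.ascFactorial_eq_factorial_mul_choose (N + 1) r
  have h2 := Nat.ascFactorial_eq_factorial_mul_choose 1 r
  rw [Nat.ascFactorial_eq_prod_range] at h1 h2
  have h3 : ‖((∏ i ∈ range r, (N + 1 + 1 + i) : ℕ) : ℚ_[3])‖ = ‖((∏ i ∈ range r, (1 + 1 + i) : ℕ) : ℚ_[3])‖ := by
    rw [Nat.cast_prod, Nat.cast_prod, norm_prod, norm_prod]
    apply prod_congr rfl
    intro i hi
    rw [mem_range] at hi
    rw [show N + 1 + 1 + i = N + (1 + 1 + i) by ring]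
    exact z3_norm_shift a N _ hN (by omega) (by omega)
  rw [h1, h2, Nat.cast_mul, Nat.cast_mul, norm_mul, norm_mul] at h3
  have h4 := mul_left_cancel₀ (z3_nat_pos (Nat.factorial_ne_zero r)).ne' h3
  rw [h4]
  have : (1 + r).choose r = r + 1 := by rw [add_comm]; simp
  rw [this]
  exact_mod_cast z3_nat_ge (n := r + 1) (by omega)

theorem z3_choose_norm (M r : ℕ) (hM : r ≤ M) : ‖((M.choose r : ℕ) : ℚ_[3])‖⁻¹ ≤ M + 1 := by
  rw [z3_nat_eq (Nat.choose_pos hM).ne', inv_inv]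
  have h1 := Nat.factorization_choose_le_log (p := 3) (n := M) (k := r)
  rw [Nat.factorization_def _ Nat.prime_three] at h1
  rcases Nat.eq_zero_or_pos M with rfl | h0
  · have : r = 0 := by omega
    subst this; simp
  have h2 := Nat.pow_log_le_self 3 h0.ne'
  have h3 : 3 ^ padicValNat 3 (M.choose r) ≤ M := (Nat.pow_le_pow_right (by norm_num) h1).trans h2
  have : (3 : ℝ) ^ padicValNat 3 (M.choose r) ≤ M := by exact_mod_cast h3
  linarith

theorem z3_pow_small (r : ℕ) (hr : 1 ≤ r) : ((r : ℝ) + 1) * (1 / 9) ^ r ≤ 1 / 2 := by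
  induction r, hr using Nat.le_induction with
  | base => norm_num
  | succ r hr ih =>
    rw [pow_succ]; push_cast
    have : (1 : ℝ) ≤ r := by exact_mod_cast hr
    have h : (0 : ℝ) < (1 / 9) ^ r := by positivity
    nlinarith

theorem z3_pow_big (r : ℕ) (hr : 8 ≤ r) : (3612 * ((r : ℝ) + 1) + r + 2) * (1 / 9) ^ r ≤ 1 / 2 := by
  induction r, hr using Nat.le_induction with
  | base => norm_num
  | succ r hr ih =>
    rw [pow_succ]; push_cast
    have : (8 : ℝ) ≤ r := by exact_mod_cast hr
    have h : (0 : ℝ) < (1 / 9) ^ r := by positivity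
    nlinarith

theorem z3_ratio (a r : ℕ) (ha : 2 ≤ a) (hr : 1 ≤ r) :
    (1 / 9 : ℝ) ^ r * ‖(((2 * (1806 * 3 ^ a) + 1 + r).choose r : ℕ) : ℚ_[3])‖⁻¹ ≤ 1 / 2 := by
  by_cases h : r + 1 < 3 ^ a
  · have := z3_choose_norm_small a (2 * (1806 * 3 ^ a)) r ⟨3612, by ring⟩ h
    refine le_trans ?_ (z3_pow_small r hr)
    rw [mul_comm]
    gcongr
  · have h1 := z3_choose_norm (2 * (1806 * 3 ^ a) + 1 + r) r (by omega)
    have h9 : 3 ^ 2 ≤ 3 ^ a := Nat.pow_le_pow_right (by norm_num) ha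
    refine le_trans ?_ (z3_pow_big r (by omega))
    rw [mul_comm]
    gcongr
    refine h1.trans ?_
    have : ((2 * (1806 * 3 ^ a) + 1 + r + 1 : ℕ) : ℝ) ≤ (3612 * (r + 1) + r + 2 : ℕ) := by
      exact_mod_cast (by omega)
    push_cast at this ⊢
    linarith

theorem z3_term_norm (n r : ℕ) : ‖((z3kap (n + r) * z3F n (n + r) : ℚ) : ℚ_[3])‖ =
    (1 / 9 : ℝ) ^ (n + r + 1) * ‖((n + r).factorial : ℚ_[3])‖ ^ 4 /
      (‖(r.factorial : ℚ_[3])‖ * ‖((2 * n + r + 1).factorial : ℚ_[3])‖) := by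
  have h := congrArg (fun x : ℚ => ‖(x : ℚ_[3])‖) (z3F_eq n r)
  push_cast at h
  rw [norm_mul, norm_mul, norm_mul, norm_pow, norm_pow, norm_neg, norm_one, one_pow, one_mul] at h
  have h1 := z3_nat_pos (Nat.factorial_ne_zero r)
  have h2 := z3_nat_pos (Nat.factorial_ne_zero (2 * n + r + 1))
  push_cast
  rw [norm_mul, z3kap_norm, eq_div_iff (by positivity)]
  linear_combination ((1 / 9 : ℝ) ^ (n + r + 1) * ‖((n + r).factorial : ℚ_[3])‖ ^ 2) * h

theorem z3_term_ratio (a r : ℕ) (ha : 2 ≤ a) (hr : 1 ≤ r) (n : ℕ) (hn : n = 1806 * 3 ^ a) :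
    ‖((z3kap (n + r) * z3F n (n + r) : ℚ) : ℚ_[3])‖ ≤ 1 / 2 * ‖((z3kap n * z3F n n : ℚ) : ℚ_[3])‖ := by
  have h0 := z3_term_norm n 0
  rw [add_zero] at h0
  rw [z3_term_norm, h0]
  have h1 := z3_ratio a r ha hr
  rw [← hn] at h1
  have e1 := Nat.add_choose_mul_factorial_mul_factorial n r
  have e2 := Nat.add_choose_mul_factorial_mul_factorial (2 * n + 1) r
  rw [show 2 * n + r + 1 = 2 * n + 1 + r by ring, ← e1, ← e2]
  push_cast
  rw [norm_mul, norm_mul, norm_mul, norm_mul]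
  have p1 := z3_nat_pos (Nat.factorial_ne_zero r)
  have p2 := z3_nat_pos (Nat.factorial_ne_zero n)
  have p3 := z3_nat_pos (Nat.factorial_ne_zero (2 * n + 1))
  have p4 := z3_nat_pos (Nat.choose_pos (show r ≤ 2 * n + 1 + r by omega)).ne'
  have q1 := z3_nat_le_one r.factorial
  have q2 := z3_nat_le_one ((n + r).choose r)
  have p5 := norm_nonneg (((n + r).choose r : ℕ) : ℚ_[3])
  set x := ‖(r.factorial : ℚ_[3])‖
  set y := ‖(n.factorial : ℚ_[3])‖
  set z := ‖((2 * n + 1).factorial : ℚ_[3])‖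
  set w := ‖(((2 * n + 1 + r).choose r : ℕ) : ℚ_[3])‖
  set v := ‖(((n + r).choose r : ℕ) : ℚ_[3])‖
  have : (1 / 9 : ℝ) ^ (n + r + 1) * (v * y * x) ^ 4 / (x * (w * z * x)) =
    ((1 / 9 : ℝ) ^ r * w⁻¹) * (v ^ 4 * x ^ 2) * ((1 / 9 : ℝ) ^ (n + 1) * y ^ 4 / z) := by
    rw [show n + r + 1 = r + (n + 1) by ring, pow_add]
    field_simp
  rw [this]
  simp only [add_zero, Nat.factorial_zero, Nat.cast_one, norm_one, one_mul]
  apply mul_le_mul_of_nonneg_right _ (by positivity)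
  have h2 : v ^ 4 * x ^ 2 ≤ 1 := mul_le_one₀ (pow_le_one₀ p5 q2) (by positivity) (pow_le_one₀ p1.le q1)
  calc _ ≤ (1 / 9 : ℝ) ^ r * w⁻¹ * 1 := by gcongr
    _ ≤ _ := by linarith

theorem z3R_norm (a : ℕ) (ha : 2 ≤ a) (n : ℕ) (hn : n = 1806 * 3 ^ a) :
    ‖(z3A n : ℚ_[3]) * z3T 0 - z3B n‖ =
      (1 / 9 : ℝ) ^ (n + 1) * ‖(n.factorial : ℚ_[3])‖ ^ 4 / ‖((2 * n + 1).factorial : ℚ_[3])‖ := by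
  have h0 := z3_term_norm n 0
  simp only [add_zero, Nat.factorial_zero, Nat.cast_one, norm_one, one_mul] at h0
  have hs := z3R_summable n
  have hpos : 0 < ‖((z3kap n * z3F n n : ℚ) : ℚ_[3])‖ := by
    rw [h0]
    have p2 := z3_nat_pos (Nat.factorial_ne_zero n)
    have p3 := z3_nat_pos (Nat.factorial_ne_zero (2 * n + 1))
    positivity
  rw [z3R_eq, ← hs.sum_add_tsum_nat_add (n + 1), sum_range_succ, sum_eq_zero, zero_add, ← h0]
  · have hb : ‖∑' i, ((z3kap (i + (n + 1)) * z3F n (i + (n + 1)) : ℚ) : ℚ_[3])‖ ≤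
        1 / 2 * ‖((z3kap n * z3F n n : ℚ) : ℚ_[3])‖ := by
      apply z3_tsum_norm_le _ ((summable_nat_add_iff (n + 1)).2 hs) _ (by positivity)
      intro i
      have := z3_term_ratio a (i + 1) ha (by omega) n hn
      rwa [show n + (i + 1) = i + (n + 1) by ring] at this
    have hlt : ‖∑' i, ((z3kap (i + (n + 1)) * z3F n (i + (n + 1)) : ℚ) : ℚ_[3])‖ <
      ‖((z3kap n * z3F n n : ℚ) : ℚ_[3])‖ := by linarith
    rw [Padic.add_eq_max_of_ne hlt.ne', max_eq_left hlt.le]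
  · intro i hi
    rw [mem_range] at hi
    rw [z3F_lt _ _ hi]; simp

theorem z3_fact_three (n : ℕ) : ‖((3 * n).factorial : ℚ_[3])‖ = (1 / 3) ^ n * ‖(n.factorial : ℚ_[3])‖ := by
  rw [z3_nat_eq (Nat.factorial_ne_zero _), z3_nat_eq (Nat.factorial_ne_zero _), padicValNat_factorial_mul,
    pow_add]
  simp [mul_comm]

theorem z3W (n a : ℕ) : (3 : ℝ) ^ (n * 3 ^ a) * ‖((n * 3 ^ a).factorial : ℚ_[3])‖ ^ 4 /
    ‖((2 * (n * 3 ^ a)).factorial : ℚ_[3])‖ = 3 ^ n * ‖(n.factorial : ℚ_[3])‖ ^ 4 / ‖((2 * n).factorial : ℚ_[3])‖ := by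
  induction a with
  | zero => simp
  | succ a ih =>
    rw [← ih, show n * 3 ^ (a + 1) = 3 * (n * 3 ^ a) by ring]
    generalize n * 3 ^ a = N
    rw [show 2 * (3 * N) = 3 * (2 * N) by ring, z3_fact_three, z3_fact_three]
    have p3 := z3_nat_pos (Nat.factorial_ne_zero (2 * N))
    rw [div_eq_div_iff (by positivity) (by positivity), pow_mul 3 3 N, pow_mul (1 / 3) 2 N, mul_pow, ← pow_mul (1 / 3) N 4, mul_comm N 4, pow_mul (1 / 3) 4 N]
    have : ((3 : ℝ) ^ 3) ^ N * ((1 / 3 : ℝ) ^ 4) ^ N = 3 ^ N * ((1 / 3) ^ 2) ^ N := by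
      rw [← mul_pow, ← mul_pow]; norm_num
    linear_combination (‖(N.factorial : ℚ_[3])‖ ^ 4 * ‖((2 * N).factorial : ℚ_[3])‖) * this

noncomputable def z3C (c : ℕ) : ℝ :=
  1 / 9 * (3 ^ c * ‖(c.factorial : ℚ_[3])‖ ^ 4 / ‖((2 * c).factorial : ℚ_[3])‖)

theorem z3C_pos (c : ℕ) : 0 < z3C c := by
  have p2 := z3_nat_pos (Nat.factorial_ne_zero c)
  have p3 := z3_nat_pos (Nat.factorial_ne_zero (2 * c))
  unfold z3C
  positivity

theorem z3R_final (a : ℕ) (ha : 2 ≤ a) (n : ℕ) (hn : n = 1806 * 3 ^ a) :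
    ‖(z3A n : ℚ_[3]) * z3T 0 - z3B n‖ = z3C 1806 * (1 / 27) ^ n := by
  rw [z3R_norm a ha n hn, z3C, ← z3W 1806 a, ← hn, Nat.factorial_succ, Nat.cast_mul, norm_mul]
  have h1 : ‖((2 * n + 1 : ℕ) : ℚ_[3])‖ = 1 := by
    rw [Padic.norm_natCast_eq_one_iff, Nat.Prime.coprime_iff_not_dvd Nat.prime_three]; omega
  rw [h1, one_mul, pow_succ, show (1 / 9 : ℝ) ^ n = 3 ^ n * (1 / 27) ^ n by rw [← mul_pow]; norm_num]
  ring

theorem z3_int_ge (Z : ℤ) (hZ : Z ≠ 0) : 1 ≤ |(Z : ℝ)| * ‖(Z : ℚ_[3])‖ := by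
  have h1 : ‖(Z : ℚ_[3])‖ = ‖((Z.natAbs : ℕ) : ℚ_[3])‖ := by
    rcases Int.natAbs_eq Z with h | h
    · conv_lhs => rw [h]
      simp
    · conv_lhs => rw [h]
      rw [Int.cast_neg, norm_neg, Int.cast_natCast]
  have h2 : |(Z : ℝ)| = (Z.natAbs : ℝ) := by
    rw [Nat.cast_natAbs, Int.cast_abs]
  have h3 : Z.natAbs ≠ 0 := by simpa using hZ
  rw [h1, h2]
  have := z3_nat_ge h3
  rwa [inv_le_iff_one_le_mul₀ (z3_nat_pos h3)] at this

theorem z3_irr (s : ℚ) : z3T 0 ≠ (s : ℚ_[3]) := by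
  intro hs
  have hC := z3C_pos 1806
  set C := z3C 1806
  set K : ℝ := s.den * (|(s : ℝ)| + 2) * C with hK
  have hK0 : 0 < K := by
    have : (0 : ℝ) < s.den := by exact_mod_cast s.den_pos
    positivity
  have main : ∀ a : ℕ, 2 ≤ a → ((3 ^ a : ℕ) : ℝ) + 1 ≤ 1806 * K := by
    intro a ha
    obtain ⟨m, hm⟩ : ∃ m, m = 3 ^ a := ⟨_, rfl⟩
    rw [← hm]
    obtain ⟨n, hn⟩ : ∃ n, n = 1806 * m := ⟨_, rfl⟩
    have hm0 : 0 < m := by rw [hm]; positivity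
    have hR := z3R_final a ha n (by rw [hn, hm])
    have hl := z3_lcm_bound m hm0
    rw [← hn] at hl
    obtain ⟨d, hd⟩ : ∃ d, d = Nat.lcmUpto n := ⟨_, rfl⟩
    rw [← hd] at hl
    obtain ⟨x, hx⟩ := z3A_int n
    obtain ⟨y, hy⟩ := z3B_int n d (fun i h1 h2 => by
      rw [hd]; exact Finset.dvd_lcm (f := id) (mem_Icc.2 ⟨h1, h2⟩))
    rw [eq_intCast] at hx hy
    set Z : ℤ := x * d ^ 3 * s.num - s.den * y with hZdef
    have hsd : (s.num : ℚ) = s.den * s := (Rat.den_mul_eq_num s).symm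
    have hZ : (Z : ℚ) = s.den * 27 ^ n * d ^ 3 * (z3A n * s - z3B n) := by
      rw [hZdef]; push_cast
      rw [hx, hy, hsd]; ring
    have hZp : ‖(Z : ℚ_[3])‖ ≤ (1 / 27) ^ n * (C * (1 / 27) ^ n) := by
      have e : (Z : ℚ_[3]) = ((s.den * d ^ 3 : ℕ) : ℚ_[3]) * (27 ^ n * ((z3A n : ℚ_[3]) * z3T 0 - z3B n)) := by
        have := congrArg (Rat.cast (K := ℚ_[3])) hZ
        push_cast at this ⊢
        rw [this, hs]; ring
      rw [e, norm_mul, norm_mul, hR, norm_pow, show (27 : ℚ_[3]) = 3 ^ 3 by norm_num, norm_pow, z3_three_norm]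
      have := z3_nat_le_one (s.den * d ^ 3)
      rw [show ((1 : ℝ) / 3) ^ 3 = 1 / 27 by norm_num]
      exact mul_le_of_le_one_left (by positivity) this
    have hZ0 : Z ≠ 0 := by
      intro h0
      have : (z3A n * s - z3B n) = 0 := by
        rw [h0] at hZ
        have h27 : (s.den * 27 ^ n * d ^ 3 : ℚ) ≠ 0 := by
          have h1 : d ≠ 0 := by rw [hd]; exact (Nat.lcmUpto_pos n).ne'
          have h2 := s.den_ne_zero
          positivity
        have h := hZ.symm
        rw [Int.cast_zero] at h
        exact (mul_eq_zero.1 h).resolve_left h27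
      have h3 : (z3A n : ℚ_[3]) * z3T 0 - z3B n = 0 := by
        rw [hs]; exact_mod_cast congrArg (Rat.cast (K := ℚ_[3])) this
      rw [h3, norm_zero] at hR
      have : 0 < C * (1 / 27) ^ n := by positivity
      linarith
    have hZr : |(Z : ℝ)| ≤ s.den * 27 ^ n * d ^ 3 * ((n + 1) * (|(s : ℝ)| + 2)) := by
      have e : |(Z : ℚ)| ≤ s.den * 27 ^ n * d ^ 3 * ((n + 1) * (|s| + 2)) := by
        rw [hZ, abs_mul, abs_of_nonneg (a := (s.den * 27 ^ n * d ^ 3 : ℚ)) (by positivity)]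
        apply mul_le_mul_of_nonneg_left _ (by positivity)
        have h1 := z3A_bound n
        have h2 := z3B_bound n
        have h3 := abs_sub (z3A n * s) (z3B n)
        rw [abs_mul] at h3
        nlinarith [mul_le_mul_of_nonneg_right h1 (abs_nonneg s)]
      exact_mod_cast e
    have h1 := z3_int_ge Z hZ0
    have h2 : 1 ≤ (s.den * 27 ^ n * d ^ 3 * ((n + 1) * (|(s : ℝ)| + 2))) * ((1 / 27) ^ n * (C * (1 / 27) ^ n)) :=
      h1.trans (mul_le_mul hZr hZp (norm_nonneg _) (by positivity))
    have hdr : (d : ℝ) * 2 ^ m ≤ 3 ^ n := by exact_mod_cast hl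
    have hd3 : (d : ℝ) ^ 3 * (2 ^ m) ^ 3 ≤ 27 ^ n := by
      have := pow_le_pow_left₀ (by positivity) hdr 3
      rw [mul_pow] at this
      refine this.trans (le_of_eq ?_)
      rw [← pow_mul, mul_comm n 3, pow_mul]; norm_num
    have hmm : (m : ℝ) + 1 ≤ 2 ^ m := by
      exact_mod_cast Nat.lt_two_pow_self (n := m)
    have h27 : (27 : ℝ) ^ n * (1 / 27) ^ n = 1 := by rw [← mul_pow]; norm_num
    have h3 : ((2 : ℝ) ^ m) ^ 3 ≤ K * (n + 1) := by
      calc ((2 : ℝ) ^ m) ^ 3 ≤ (2 ^ m) ^ 3 * ((s.den * 27 ^ n * d ^ 3 * ((n + 1) * (|(s : ℝ)| + 2))) * ((1 / 27) ^ n * (C * (1 / 27) ^ n))) :=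
            le_mul_of_one_le_right (by positivity) h2
        _ = (d ^ 3 * (2 ^ m) ^ 3) * ((27 : ℝ) ^ n * (1 / 27) ^ n) * (1 / 27) ^ n * (K * (n + 1)) := by rw [hK]; ring
        _ ≤ 27 ^ n * ((27 : ℝ) ^ n * (1 / 27) ^ n) * (1 / 27) ^ n * (K * (n + 1)) := by gcongr
        _ = K * (n + 1) := by rw [h27, mul_one, h27, one_mul]
    have h4 : ((m : ℝ) + 1) ^ 2 ≤ (2 ^ m) ^ 3 := by
      have h5 : (1 : ℝ) ≤ 2 ^ m := one_le_pow₀ (by norm_num)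
      calc ((m : ℝ) + 1) ^ 2 ≤ (2 ^ m) ^ 2 := by gcongr
        _ ≤ _ := pow_le_pow_right₀ h5 (by norm_num)
    have h6 : K * ((n : ℝ) + 1) ≤ K * (1806 * (m + 1)) := by
      apply mul_le_mul_of_nonneg_left _ hK0.le
      rw [hn]; push_cast; linarith
    have hm1 : (0 : ℝ) < m + 1 := by positivity
    nlinarith
  obtain ⟨a, ha⟩ := exists_nat_gt (1806 * K)
  have h1 := main (a + 2) (by omega)
  have h2 : a + 2 < 3 ^ (a + 2) := Nat.lt_pow_self (by norm_num)
  have h3 : ((a + 2 : ℕ) : ℝ) < ((3 ^ (a + 2) : ℕ) : ℝ) := by exact_mod_cast h2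
  push_cast at h1 h3
  linarith

/-! ### Newton expansion of power sums and Bernoulli numbers -/

def z3D : ℕ → ℕ → ℤ
  | 0, _ => 0
  | 1, 0 => 1
  | 1, _ + 1 => 0
  | n + 2, 0 => z3D (n + 1) 0 + 2 * z3D n 0
  | n + 2, m + 1 => z3D (n + 1) (m + 1) + (9 * (m + 1) * (m + 2) + 2) * z3D n (m + 1) + z3D n m

theorem z3D_zero : ∀ n m : ℕ, n ≤ m → z3D n m = 0
  | 0, m, _ => by unfold z3D; rfl
  | 1, m, h => by
    obtain ⟨m, rfl⟩ : ∃ m', m = m' + 1 := ⟨m - 1, by omega⟩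
    unfold z3D; rfl
  | n + 2, m, h => by
    obtain ⟨m, rfl⟩ : ∃ m', m = m' + 1 := ⟨m - 1, by omega⟩
    rw [z3D, z3D_zero (n + 1) (m + 1) (by omega), z3D_zero n (m + 1) (by omega), z3D_zero n m (by omega)]
    simp

def z3b (m : ℕ) (t : ℚ) : ℚ := ∏ i ∈ range m, (t * (t + 1) - i * (i + 1))

theorem z3b_succ (m : ℕ) (t : ℚ) : z3b (m + 1) t = z3b m t * (t * (t + 1) - m * (m + 1)) := by
  unfold z3b; rw [prod_range_succ]

theorem z3b_zero (t : ℚ) : z3b 0 t = 1 := by simp [z3b]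

theorem z3D_step (n N : ℕ) (t : ℚ) : ∑ m ∈ range (N + 1), (z3D (n + 2) m : ℚ) * (9 ^ m * z3b m t) =
    ∑ m ∈ range (N + 1), (z3D (n + 1) m : ℚ) * (9 ^ m * z3b m t) +
    (9 * t * (t + 1) + 2) * ∑ m ∈ range (N + 1), (z3D n m : ℚ) * (9 ^ m * z3b m t) -
    z3D n N * (9 ^ (N + 1) * z3b (N + 1) t) := by
  induction N with
  | zero =>
    simp only [zero_add, sum_range_one, z3b_succ, z3b_zero]
    rw [z3D]; push_cast; ring
  | succ N ih =>
    rw [sum_range_succ, ih, sum_range_succ _ (N + 1), sum_range_succ _ (N + 1), z3D, z3b_succ (N + 1)]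
    push_cast
    ring

theorem z3_lucas (N : ℕ) (t : ℚ) : ∀ n : ℕ, n ≤ N + 1 → (3 * t + 2) ^ n - (-(3 * t + 1)) ^ n =
    (6 * t + 3) * ∑ m ∈ range (N + 1), (z3D n m : ℚ) * (9 ^ m * z3b m t)
  | 0, _ => by simp [z3D]
  | 1, _ => by
    rw [sum_eq_single 0]
    · simp [z3D, z3b_zero]; ring
    · intro m _ hm
      rw [z3D_zero 1 m (by omega)]; simp
    · simp
  | n + 2, h => by
    rw [z3D_step, z3D_zero n N (by omega)]
    have h1 := z3_lucas N t (n + 1) (by omega)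
    have h2 := z3_lucas N t n (by omega)
    rw [pow_succ] at h1
    push_cast
    linear_combination h1 + (9 * t * (t + 1) + 2) * h2

theorem z3_odd (k : ℕ) (t : ℚ) : (3 * t + 1) ^ (2 * k + 1) + (3 * t + 2) ^ (2 * k + 1) =
    (6 * t + 3) * ∑ m ∈ range (2 * k + 1), (z3D (2 * k + 1) m : ℚ) * (9 ^ m * z3b m t) := by
  rw [← z3_lucas (2 * k) t (2 * k + 1) le_rfl, Odd.neg_pow ⟨k, rfl⟩]; ring

open Polynomial in
/-- `X^2 ∏_{l<m} (X^2 - (l+1)^2)` -/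
noncomputable def z3U (m : ℕ) : ℚ[X] := X ^ 2 * ∏ l ∈ range m, (X ^ 2 - C (((l : ℚ) + 1) ^ 2))

theorem z3U_eval (m : ℕ) (t : ℚ) : (z3U m).eval t = t ^ 2 * ∏ l ∈ range m, (t ^ 2 - ((l : ℚ) + 1) ^ 2) := by
  unfold z3U
  simp [Polynomial.eval_prod]

theorem z3U_left (m : ℕ) (t : ℚ) : (z3U m).eval t = t * (t - m) * z3b m t := by
  rw [z3U_eval]
  induction m with
  | zero => simp [z3b_zero]; ring
  | succ m ih =>
    rw [prod_range_succ, ← mul_assoc, ih, z3b_succ]; push_cast; ring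

theorem z3U_right (m : ℕ) (t : ℚ) : (z3U m).eval (t + 1) = (t + 1) * (t + 1 + m) * z3b m t := by
  rw [z3U_eval]
  induction m with
  | zero => simp [z3b_zero]; ring
  | succ m ih =>
    rw [prod_range_succ, ← mul_assoc, ih, z3b_succ]; push_cast; ring

theorem z3U_sum (m M : ℕ) : ∑ i ∈ range M, (2 * (i : ℚ) + 1) * z3b m i = (z3U m).eval (M : ℚ) / (m + 1) := by
  induction M with
  | zero => simp [z3U_eval]
  | succ M ih =>
    have hm : (m : ℚ) + 1 ≠ 0 := by positivity
    rw [sum_range_succ, ih]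
    push_cast
    rw [z3U_right, z3U_left]
    field_simp
    ring

theorem z3U_coeff (m : ℕ) : (z3U m).coeff 2 = (-1) ^ m * (m.factorial : ℚ) ^ 2 := by
  unfold z3U
  rw [Polynomial.coeff_X_pow_mul', if_pos le_rfl, Nat.sub_self, Polynomial.coeff_zero_eq_eval_zero,
    Polynomial.eval_prod]
  induction m with
  | zero => simp
  | succ m ih =>
    rw [prod_range_succ, ih, Nat.factorial_succ]; simp; ring

theorem z3_split (s M : ℕ) : ∑ i ∈ range (3 * M), (i : ℚ) ^ s = 3 ^ s * ∑ i ∈ range M, (i : ℚ) ^ s +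
    ∑ i ∈ range M, ((3 * (i : ℚ) + 1) ^ s + (3 * (i : ℚ) + 2) ^ s) := by
  induction M with
  | zero => simp
  | succ M ih =>
    rw [show 3 * (M + 1) = 3 * M + 1 + 1 + 1 by ring, sum_range_succ, sum_range_succ, sum_range_succ, ih,
      sum_range_succ _ M, sum_range_succ _ M]
    push_cast
    ring

open Polynomial in
theorem z3_bern (k : ℕ) (hk : 0 < k) : (1 - (3 : ℚ) ^ (2 * k - 1)) * _root_.bernoulli (2 * k) =
    2 / 3 / (2 * k + 1) * ∑ m ∈ range (2 * k + 1), (z3D (2 * k + 1) m : ℚ) *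
      ((-9) ^ m * (m.factorial : ℚ) ^ 2 / (m + 1)) := by
  set s := 2 * k + 1 with hs
  set Bp : ℚ[X] := Polynomial.bernoulli (s + 1) with hBp
  have key : Bp.comp (C 3 * X) - C (3 ^ s) * Bp - C ((1 - 3 ^ s) * _root_.bernoulli (s + 1)) =
      C ((s : ℚ) + 1) * ∑ m ∈ range s, C (3 * (z3D s m : ℚ) * 9 ^ m / (m + 1)) * z3U m := by
    apply Polynomial.eq_of_infinite_eval_eq
    apply Set.Infinite.mono (s := Set.range (Nat.cast : ℕ → ℚ)) _ (Set.infinite_range_of_injective Nat.cast_injective)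
    rintro _ ⟨M, rfl⟩
    rw [Set.mem_ofPred_eq]
    have h1 := Polynomial.sum_range_pow_eq_bernoulli_sub (3 * M) s
    have h2 := Polynomial.sum_range_pow_eq_bernoulli_sub M s
    have h3 := z3_split s M
    have h4 : ∑ i ∈ range M, ((3 * (i : ℚ) + 1) ^ s + (3 * (i : ℚ) + 2) ^ s) =
        ∑ m ∈ range s, 3 * (z3D s m : ℚ) * 9 ^ m / (m + 1) * (z3U m).eval (M : ℚ) := by
      simp_rw [hs, z3_odd, mul_sum]
      rw [sum_comm]
      apply sum_congr rfl
      intro m _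
      rw [div_mul_eq_mul_div, mul_div_assoc, ← z3U_sum, mul_sum]
      apply sum_congr rfl
      intro i _
      ring
    simp only [eval_sub, eval_mul, eval_comp, eval_C, eval_X, eval_finsetSum]
    rw [← h4]
    push_cast at h1
    linear_combination -h1 + (3 : ℚ) ^ s * h2 + ((s : ℚ) + 1) * h3
  have kc := congrArg (fun p => Polynomial.coeff p 2) key
  have hB : Bp.coeff 2 = _root_.bernoulli (2 * k) * ((k + 1) * (2 * k + 1)) := by
    rw [hBp, Polynomial.coeff_bernoulli, if_pos (by omega), hs, show 2 * k + 1 + 1 - 2 = 2 * k by omega,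
      Nat.cast_choose_two]
    push_cast; ring
  simp only [coeff_sub, coeff_C_mul, finsetSum_coeff, comp_C_mul_X_coeff, hB, z3U_coeff, coeff_C] at kc
  norm_num at kc
  have hsum : ∑ m ∈ range s, (z3D s m : ℚ) * ((-9) ^ m * (m.factorial : ℚ) ^ 2 / (m + 1)) =
     (1 / 3) * ∑ m ∈ range s, (3 * (z3D s m : ℚ) * 9 ^ m / (m + 1)) * ((-1) ^ m * (m.factorial : ℚ) ^ 2) := by
    rw [mul_sum]
    apply sum_congr rfl
    intro m _
    rw [show (-9 : ℚ) = 9 * (-1) by norm_num, mul_pow]; ring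
  rw [hsum]
  have h3 : (3 : ℚ) ^ s = 9 * 3 ^ (2 * k - 1) := by
    rw [hs, show 2 * k + 1 = 2 * k - 1 + 2 by omega, pow_add]; norm_num; ring
  rw [h3] at kc
  have hk1 : (k : ℚ) + 1 ≠ 0 := by positivity
  have hk2 : 2 * (k : ℚ) + 1 ≠ 0 := by positivity
  have hsc : (s : ℚ) + 1 = 2 * (k + 1) := by rw [hs]; push_cast; ring
  rw [hsc] at kc
  generalize ∑ m ∈ range s, (3 * (z3D s m : ℚ) * 9 ^ m / (m + 1)) * ((-1) ^ m * (m.factorial : ℚ) ^ 2) = W at kc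
  field_simp
  apply mul_left_cancel₀ hk1
  linear_combination kc

theorem z3_star (t : ℚ) (ht1 : 3 * t + 1 ≠ 0) (ht2 : 3 * t + 2 ≠ 0) (N : ℕ) :
    ∑ l ∈ range N, ((-1) ^ l / z3p (l + 1) : ℚ) * (9 ^ l * z3b l t) =
    (1 - (-1) ^ N * (9 ^ N * z3b N t) / z3p N) / ((3 * t + 1) * (3 * t + 2)) := by
  induction N with
  | zero => simp [z3b_zero, z3p]
  | succ N ih =>
    have hp : (z3p N : ℚ) ≠ 0 := by exact_mod_cast (z3p_pos N).ne'
    have h1 : (3 * (N : ℚ) + 1) ≠ 0 := by positivity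
    have h2 : (3 * (N : ℚ) + 2) ≠ 0 := by positivity
    rw [sum_range_succ, ih, z3b_succ, z3p_succ]
    push_cast
    field_simp
    ring

theorem z3b_self (m : ℕ) : z3b (m + 1) (m : ℚ) = 0 := by
  rw [z3b_succ]; ring

theorem z3b_big (m l : ℕ) (h : m < l) : z3b l (m : ℚ) = 0 := by
  unfold z3b
  apply prod_eq_zero (mem_range.2 h); ring

theorem z3b_ne (m : ℕ) : z3b m (m : ℚ) ≠ 0 := by
  unfold z3b
  rw [prod_ne_zero_iff]
  intro i hi
  rw [mem_range] at hi
  have h : (i : ℚ) < m := by exact_mod_cast hi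
  have h0 : (0 : ℚ) ≤ i := by positivity
  nlinarith

theorem z3_star_self (m : ℕ) : ∑ l ∈ range (m + 1), ((-1) ^ l / z3p (l + 1) : ℚ) * (9 ^ l * z3b l m) =
    1 / ((3 * m + 1) * (3 * m + 2)) := by
  rw [z3_star _ (by positivity) (by positivity), z3b_self]; simp

theorem z3_eval (k m : ℕ) : ∑ l ∈ range (m + 1), (z3D (2 * k + 1) l : ℚ) * (9 ^ l * z3b l m) =
    ((3 * m + 1) ^ (2 * k + 1) + (3 * m + 2) ^ (2 * k + 1)) / (6 * m + 3) := by
  rw [z3_odd, mul_div_cancel_left₀ _ (by positivity)]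
  rcases le_total (m + 1) (2 * k + 1) with h | h
  · apply sum_subset (range_mono h)
    intro l _ hl
    rw [mem_range] at hl
    rw [z3b_big m l (by omega)]; simp
  · symm
    apply sum_subset (range_mono h)
    intro l _ hl
    rw [mem_range] at hl
    rw [z3D_zero _ l (by omega)]; simp

section
open Filter

theorem z3_pow_tendsto (k : ℕ → ℕ) (hk : Tendsto (fun j => ‖(k j : ℚ_[3]) + 1‖) atTop (nhds 0))
    (x : ℕ) (hx : ¬ 3 ∣ x) : Tendsto (fun j => (x : ℚ_[3]) ^ (2 * k j + 1)) atTop (nhds (x : ℚ_[3])⁻¹) := by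
  have hx0 : (x : ℚ_[3]) ≠ 0 := by
    have : x ≠ 0 := by rintro rfl; simp at hx
    exact_mod_cast this
  have hd : ∀ N : ℕ, ∀ᶠ j in atTop, 3 ^ N ∣ k j + 1 := by
    intro N
    have h := hk.eventually (gt_mem_nhds (show (0 : ℝ) < (3 : ℝ) ^ (-N : ℤ) by positivity))
    filter_upwards [h] with j hj
    have := (Padic.norm_int_le_pow_iff_dvd (p := 3) ((k j + 1 : ℕ) : ℤ) N).1 (by
      push_cast; exact_mod_cast hj.le)
    exact_mod_cast this
  have h2 : ((3 : ℕ) : ℤ) ∣ (x : ℤ) ^ 2 - 1 := by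
    have : (x : ℤ) % 3 = 1 ∨ (x : ℤ) % 3 = 2 := by omega
    apply Int.dvd_of_emod_eq_zero
    rcases this with h | h <;> simp [pow_two, Int.sub_emod, Int.mul_emod, h]
  have h1 : Tendsto (fun j => (x : ℚ_[3]) ^ (2 * (k j + 1))) atTop (nhds 1) := by
    rw [tendsto_iff_norm_sub_tendsto_zero, Metric.tendsto_nhds]
    intro ε hε
    obtain ⟨N, hN⟩ := exists_pow_lt_of_lt_one hε (show (1 / 3 : ℝ) < 1 by norm_num)
    filter_upwards [hd N] with j ⟨w, hw⟩
    have h3 := dvd_sub_pow_of_dvd_sub (R := ℤ) (p := 3) (a := (x : ℤ) ^ 2) (b := 1) h2 N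
    rw [one_pow] at h3
    have h4 : ((3 : ℤ) ^ N) ∣ (x : ℤ) ^ (2 * (k j + 1)) - 1 := by
      rw [hw, pow_mul, pow_mul]
      have h5 := sub_one_dvd_pow_sub_one (((x : ℤ) ^ 2) ^ 3 ^ N) w
      exact ((pow_dvd_pow 3 (Nat.le_succ N)).trans (by exact_mod_cast h3)).trans h5
    have h6 := (Padic.norm_int_le_pow_iff_dvd (p := 3) ((x : ℤ) ^ (2 * (k j + 1)) - 1) N).2 (by exact_mod_cast h4)
    push_cast at h6
    rw [dist_zero_right, norm_norm]
    refine h6.trans_lt (lt_of_eq_of_lt ?_ hN)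
    simp
  have h7 := h1.mul_const (x : ℚ_[3])⁻¹
  rw [one_mul] at h7
  refine h7.congr fun j => ?_
  rw [show 2 * (k j + 1) = 2 * k j + 1 + 1 by ring, pow_succ, mul_assoc, mul_inv_cancel₀ hx0, mul_one]

theorem z3D_tendsto (k : ℕ → ℕ) (hk : Tendsto (fun j => ‖(k j : ℚ_[3]) + 1‖) atTop (nhds 0)) (m : ℕ) :
    Tendsto (fun j => (z3D (2 * k j + 1) m : ℚ_[3])) atTop (nhds (((-1) ^ m / z3p (m + 1) : ℚ) : ℚ_[3])) := by
  induction m using Nat.strong_induction_on with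
  | _ m ih =>
  have hc : ((9 ^ m * z3b m m : ℚ) : ℚ_[3]) ≠ 0 := by
    have : (9 ^ m * z3b m m : ℚ) ≠ 0 := mul_ne_zero (by positivity) (z3b_ne m)
    exact_mod_cast this
  have h1 := z3_pow_tendsto k hk (3 * m + 1) (by omega)
  have h2 := z3_pow_tendsto k hk (3 * m + 2) (by omega)
  have h3 := (h1.add h2).div_const ((6 * m + 3 : ℕ) : ℚ_[3])
  have h4 : Tendsto (fun j => ∑ l ∈ range m, (z3D (2 * k j + 1) l : ℚ_[3]) * ((9 ^ l * z3b l m : ℚ) : ℚ_[3])) atTop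
      (nhds (∑ l ∈ range m, (((-1) ^ l / z3p (l + 1) : ℚ) : ℚ_[3]) * ((9 ^ l * z3b l m : ℚ) : ℚ_[3]))) :=
    tendsto_finsetSum _ fun l hl => (ih l (mem_range.1 hl)).mul_const _
  have h5 := (h3.sub h4).div_const ((9 ^ m * z3b m m : ℚ) : ℚ_[3])
  have e1 : (((3 * m + 1 : ℕ) : ℚ_[3])⁻¹ + ((3 * m + 2 : ℕ) : ℚ_[3])⁻¹) / ((6 * m + 3 : ℕ) : ℚ_[3]) =
      ((1 / ((3 * m + 1) * (3 * m + 2)) : ℚ) : ℚ_[3]) := by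
    have : (1 / ((3 * m + 1) * (3 * m + 2)) : ℚ) = (((3 * m + 1 : ℕ) : ℚ)⁻¹ + ((3 * m + 2 : ℕ) : ℚ)⁻¹) / ((6 * m + 3 : ℕ) : ℚ) := by
      push_cast
      have h1 : (3 * (m : ℚ) + 1) ≠ 0 := by positivity
      have h2 : (3 * (m : ℚ) + 2) ≠ 0 := by positivity
      have h2 : (6 * (m : ℚ) + 3) ≠ 0 := by positivity
      field_simp
      ring
    rw [this]; push_cast; rfl
  convert h5 using 2
  · rename_i j
    rw [eq_div_iff hc, eq_sub_iff_add_eq']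
    have := congrArg (Rat.cast (K := ℚ_[3])) (z3_eval (k j) m)
    rw [sum_range_succ] at this
    push_cast at this ⊢
    exact this
  · rw [e1, eq_div_iff hc, eq_sub_iff_add_eq', ← z3_star_self, sum_range_succ]
    push_cast
    rfl

theorem z3_limit (k : ℕ → ℕ) (hk0 : ∀ j, 0 < k j)
    (hk : Tendsto (fun j => ‖(k j : ℚ_[3]) + 1‖) atTop (nhds 0)) :
    Tendsto (fun j => ((-((1 - (3 : ℚ) ^ (2 * k j - 1)) * bernoulli (2 * k j) / (2 * k j)) : ℚ) : ℚ_[3]))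
      atTop (nhds (-(1 / 27) * z3T 0)) := by
  have h1 : Tendsto (fun j => ∑' m : ℕ, (z3D (2 * k j + 1) m : ℚ_[3]) *
      (((-9) ^ m * (m.factorial : ℚ) ^ 2 / (m + 1) : ℚ) : ℚ_[3])) atTop
      (nhds (∑' m : ℕ, (((-1) ^ m / z3p (m + 1) : ℚ) : ℚ_[3]) *
        (((-9) ^ m * (m.factorial : ℚ) ^ 2 / (m + 1) : ℚ) : ℚ_[3]))) := by
    refine tendsto_tsum_of_dominated_convergence (bound := fun m : ℕ => 9 * ((1 / 9 : ℝ) ^ (m + 1) * ((0 : ℕ) + m + 1)))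
      ((z3_bound_summable 0).mul_left 9) (fun m => (z3D_tendsto k hk m).mul_const _) ?_
    refine Eventually.of_forall fun j m => ?_
    have ha := Padic.norm_int_le_one (p := 3) (z3D (2 * k j + 1) m)
    have hb := z3_nat_le_one m.factorial
    have hc := z3_nat_ge (n := m + 1) (by omega)
    push_cast at hc ⊢
    rw [norm_mul, norm_div, norm_mul, norm_pow, norm_pow, norm_neg, z3_nine_norm, div_eq_mul_inv]
    have hb2 : ‖(m.factorial : ℚ_[3])‖ ^ 2 ≤ 1 := pow_le_one₀ (norm_nonneg _) hb
    calc _ ≤ 1 * ((1 / 9 : ℝ) ^ m * 1 * (m + 1)) := by gcongr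
      _ = _ := by rw [pow_succ]; ring
  have hk' : Tendsto (fun j => (k j : ℚ_[3])) atTop (nhds (-1)) := by
    rw [tendsto_iff_norm_sub_tendsto_zero]
    refine hk.congr fun j => ?_
    rw [sub_neg_eq_add]
  have hden : Tendsto (fun j => (-(2 / 3) / ((2 * (k j : ℚ_[3]) + 1) * (2 * k j)) : ℚ_[3])) atTop
      (nhds (-(2 / 3) / ((2 * (-1) + 1) * (2 * (-1))))) := by
    apply Tendsto.div tendsto_const_nhds
    · exact (((hk'.const_mul 2).add_const 1)).mul (hk'.const_mul 2)
    · norm_num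
  have h2 := hden.mul h1
  have e : -(2 / 3) / ((2 * (-1) + 1) * (2 * (-1))) * (∑' m : ℕ, (((-1) ^ m / z3p (m + 1) : ℚ) : ℚ_[3]) *
        (((-9) ^ m * (m.factorial : ℚ) ^ 2 / (m + 1) : ℚ) : ℚ_[3])) = -(1 / 27) * z3T 0 := by
    unfold z3T
    rw [← tsum_mul_left, ← tsum_mul_left]
    congr 1
    ext m
    have : -(2 / 3) / ((2 * (-1) + 1) * (2 * (-1))) * (((-1) ^ m / z3p (m + 1) : ℚ) * ((-9) ^ m * (m.factorial : ℚ) ^ 2 / (m + 1))) =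
      -(1 / 27) * (z3kap m / ((0 : ℕ) + m + 1)) := by
      unfold z3kap
      have hp : (z3p (m + 1) : ℚ) ≠ 0 := by exact_mod_cast (z3p_pos _).ne'
      rw [show (-9 : ℚ) = 9 * (-1) by norm_num, mul_pow]
      have hm : (-1 : ℚ) ^ m * (-1) ^ m = 1 := by rw [← mul_pow]; norm_num
      norm_num
      field_simp
      linear_combination (27 * (9 : ℚ) ^ m) * hm
    have h9 := congrArg (Rat.cast (K := ℚ_[3])) this
    push_cast at h9 ⊢
    exact h9
  rw [e] at h2
  refine h2.congr fun j => ?_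
  rw [z3_bern (k j) (hk0 j), tsum_eq_sum (s := range (2 * k j + 1))]
  · push_cast
    have hk1 : (k j : ℚ_[3]) ≠ 0 := by exact_mod_cast (hk0 j).ne'
    have hk2 : 2 * (k j : ℚ_[3]) + 1 ≠ 0 := by exact_mod_cast Nat.succ_ne_zero (2 * k j)
    generalize ∑ x ∈ range (2 * k j + 1), (z3D (2 * k j + 1) x : ℚ_[3]) *
      ((-9) ^ x * (x.factorial : ℚ_[3]) ^ 2 / (x + 1)) = W
    field_simp
  · intro m hm
    rw [mem_range, not_lt] at hm
    rw [z3D_zero _ _ hm]; simp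

end

end Z3Helpers

theorem stmt_4 (η : ℚ_[3])
    (hη : ∃ k : ℕ → ℕ, (∀ j, 0 < k j) ∧
      Filter.Tendsto (fun j => (k j : ℝ)) Filter.atTop Filter.atTop ∧
      Filter.Tendsto (fun j => ‖(k j : ℚ_[3]) + 1‖) Filter.atTop (nhds 0) ∧
      Filter.Tendsto
        (fun j => ((-((1 - (3 : ℚ) ^ (2 * k j - 1)) * bernoulli (2 * k j) / (2 * k j)) : ℚ) : ℚ_[3]))
        Filter.atTop (nhds η)) :
    ∀ r : ℚ, η ≠ (r : ℚ_[3]) := by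
  obtain ⟨k, hk0, _, hk, hlim⟩ := hη
  intro r hr
  have h1 := tendsto_nhds_unique hlim (z3_limit k hk0 hk)
  apply z3_irr (-27 * r)
  push_cast
  rw [← hr, h1]
  ring
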